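/- Let p > 607 be prime, let A, k be integers with |A| < p/2, p ∤ A, 1 ≤ k < p−1 and gcd(k, p−1) = 1, let 2 ≤ n < p, and let 0 ≤ i, j ≤ n−1. Set d = gcd(k−1, p−1). Then |f(I_i) ∩ I_j| = p^{−1}|I_i||I_j| + E, where |E| ≤ (d + 1 + 2.293·p^{89/92})·((4/π²)·log p + 0.381)², and p/n² − 1 < p^{−1}|I_i||I_j| < p/n² + 1. Moreover, for 7 ≤ p ≤ 607 the same result holds with the constant 0.381 replaced by 1/2. -/

import Mathlib

/-- `Iclass p n j` is the residue class `I_j = {x : 1 ≤ x ≤ p-1, x ≡ j (mod n)}`. -/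
def Iclass (p n j : ℕ) : Finset ℕ :=
  (Finset.Icc 1 (p - 1)).filter fun x => x % n = j

/-- `fmap p A k x` is `A x^k mod p`, the least residue in `{0, …, p-1}`. -/
def fmap (p : ℕ) (A : ℤ) (k : ℕ) (x : ℕ) : ℕ :=
  ((A : ZMod p) * (x : ZMod p) ^ k).val

section StepanovMethod

open Polynomial

variable {K : Type*} [Field K]

/-- A high-order zero of `F` at `y` can be detected with the derivation `w * d/dX` when `w y ≠ 0`,
as long as the order does not exceed the characteristic. -/
theorem pow_dvd_of_iterate_mul_derivative (p : ℕ) [CharP K p] (w : K[X]) (y : K)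
    (hw : w.eval y ≠ 0) :
    ∀ M : ℕ, M ≤ p → ∀ F : K[X],
      (∀ m < M, ((fun P => w * derivative P)^[m] F).eval y = 0) → (X - C y) ^ M ∣ F := by
  intro M
  induction M with
  | zero => intro _ F _; simp
  | succ M ih =>
    intro hM F hF
    have h0 : F.eval y = 0 := by simpa using hF 0 (Nat.succ_pos M)
    have h1 : (X - C y) ^ M ∣ w * derivative F := by
      refine ih (by omega) _ fun m hm => ?_
      have := hF (m + 1) (by omega)
      rwa [Function.iterate_succ_apply] at this
    have hcop : IsCoprime ((X - C y) ^ M) w := by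
      refine IsCoprime.pow_left ?_
      refine (Polynomial.irreducible_X_sub_C y).coprime_iff_not_dvd.2 ?_
      rwa [dvd_iff_isRoot]
    have h2 : (X - C y) ^ M ∣ derivative F := hcop.dvd_of_dvd_mul_left h1
    by_cases hF0 : F = 0
    · simp [hF0]
    rw [← le_rootMultiplicity_iff hF0]
    by_contra! hlt
    have hroot : F.IsRoot y := h0
    have hpos : 0 < F.rootMultiplicity y := (rootMultiplicity_pos hF0).2 hroot
    have hcast : ((F.rootMultiplicity y : ℕ) : K) ≠ 0 := by
      rw [Ne, CharP.cast_eq_zero_iff K p]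
      exact fun h => absurd (Nat.le_of_dvd hpos h) (by omega)
    have hd := derivative_rootMultiplicity_of_root_of_mem_nonZeroDivisors hroot
      (mem_nonZeroDivisors_of_ne_zero hcast)
    by_cases hF' : derivative F = 0
    · obtain ⟨G, hG⟩ := exists_eq_pow_rootMultiplicity_mul_and_not_dvd F hF0 y
      obtain ⟨t, ht⟩ : ∃ t, F.rootMultiplicity y = t + 1 := ⟨_, (Nat.succ_pred_eq_of_pos hpos).symm⟩
      rw [ht] at hG hcast
      apply hG.2
      have := hG.1
      apply_fun derivative at this
      rw [hF', derivative_mul, derivative_pow, derivative_sub, derivative_X, derivative_C] at this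
      have h3 : (X - C y) ^ t * (C ((t + 1 : ℕ) : K) * G + (X - C y) * derivative G) = 0 := by
        rw [this]; simp only [Nat.add_sub_cancel]; ring
      have h4 := (mul_eq_zero.1 h3).resolve_left (pow_ne_zero _ (X_sub_C_ne_zero y))
      have h5 : (X - C y) ∣ C ((t + 1 : ℕ) : K) * G :=
        ⟨-derivative G, by linear_combination h4⟩
      have hu : IsUnit (C ((t + 1 : ℕ) : K)) := isUnit_C.2 (isUnit_iff_ne_zero.2 hcast)
      exact (hu.dvd_mul_left).1 h5
    · have := (le_rootMultiplicity_iff hF').2 h2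
      omega

/-- A polynomial with few terms, whose exponents are distinct modulo the characteristic, cannot
vanish to high order at a nonzero point. -/
theorem coeff_eq_zero_of_pow_dvd_sparse {ι : Type*} [Fintype ι] (e : ι → ℕ)
    (he : Function.Injective fun i => (e i : K)) (c : ι → K) {ρ : K} (hρ : ρ ≠ 0) {N : ℕ}
    (hN : Fintype.card ι ≤ N) (h : (X - C ρ) ^ N ∣ ∑ i, C (c i) * X ^ e i) : c = 0 := by
  have key : ∀ m ≤ N, (X - C ρ) ^ (N - m) ∣ ∑ i, C (c i * (e i : K) ^ m) * X ^ e i := by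
    intro m
    induction m with
    | zero => intro _; simpa using h
    | succ m ih =>
      intro hm
      have h1 := pow_sub_one_dvd_derivative_of_pow_dvd (ih (by omega))
      have h2 := h1.mul_left X
      rw [Nat.sub_sub] at h2
      convert h2 using 1
      rw [derivative_sum, Finset.mul_sum]
      refine Finset.sum_congr rfl fun i _ => ?_
      rw [derivative_C_mul_X_pow]
      rcases Nat.eq_zero_or_pos (e i) with h0 | h0
      · simp [h0]
      · obtain ⟨t, ht⟩ : ∃ t, e i = t + 1 := ⟨_, (Nat.succ_pred_eq_of_pos h0).symm⟩
        rw [ht]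
        simp only [Nat.add_sub_cancel, map_mul, map_pow]
        ring
  have hev : ∀ m < N, ∑ i, (c i * ρ ^ e i) * (e i : K) ^ m = 0 := by
    intro m hm
    have h1 : (X - C ρ) ∣ ∑ i, C (c i * (e i : K) ^ m) * X ^ e i :=
      (dvd_pow_self _ (by omega)).trans (key m hm.le)
    rw [dvd_iff_isRoot, IsRoot.def, eval_finsetSum] at h1
    rw [← h1]
    refine Finset.sum_congr rfl fun i _ => ?_
    simp only [eval_mul, eval_C, eval_pow, eval_X]
    ring
  let σ := Fintype.equivFin ι
  have hz := Matrix.eq_zero_of_forall_pow_sum_mul_pow_eq_zero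
    (f := fun j => (e (σ.symm j) : K)) (v := fun j => c (σ.symm j) * ρ ^ e (σ.symm j))
    (fun a b hab => σ.symm.injective (he hab)) (fun j => by
      rw [← hev j (lt_of_lt_of_le j.2 hN)]
      exact σ.symm.sum_comp fun i => (c i * ρ ^ e i) * (e i : K) ^ (j : ℕ))
  funext i
  have := congrFun hz (σ i)
  simpa [hρ] using this

/-- The operator `q ↦ X f g q' + (α f g + β X f' g + γ X f g') q`, which describes how the
derivation `X f g d/dX` acts on multiples of `X ^ α * f ^ β * g ^ γ`. -/
noncomputable def twistedDerivation (f g : K[X]) (α β γ : ℕ) : K[X] →ₗ[K] K[X] :=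
  LinearMap.mulLeft K (C (α : K) * f * g + C (β : K) * X * derivative f * g
    + C (γ : K) * X * f * derivative g) + LinearMap.mulLeft K (X * f * g) ∘ₗ derivative

theorem twistedDerivation_apply (f g : K[X]) (α β γ : ℕ) (q : K[X]) :
    twistedDerivation f g α β γ q =
      (C (α : K) * f * g + C (β : K) * X * derivative f * g + C (γ : K) * X * f * derivative g) * q
        + X * f * g * derivative q := rfl

theorem X_mul_derivative_pow (P : K[X]) (n : ℕ) :
    P * derivative (P ^ n) = C (n : K) * derivative P * P ^ n := by
  rcases n with _ | n
  · simp
  · rw [derivative_pow]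
    simp only [Nat.add_sub_cancel]
    ring

theorem iterate_mul_derivative_eq (f g : K[X]) (α β γ : ℕ) (q : K[X]) (m : ℕ) :
    (fun P => X * f * g * derivative P)^[m] (X ^ α * f ^ β * g ^ γ * q) =
      X ^ α * f ^ β * g ^ γ * (twistedDerivation f g α β γ ^ m) q := by
  induction m with
  | zero => simp
  | succ m ih =>
    rw [Function.iterate_succ_apply', ih, pow_succ', Module.End.mul_apply,
      twistedDerivation_apply]
    set Q := (twistedDerivation f g α β γ ^ m) q
    simp only [derivative_mul]
    have h1 := X_mul_derivative_pow (X : K[X]) α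
    have h2 := X_mul_derivative_pow f β
    have h3 := X_mul_derivative_pow g γ
    rw [derivative_X] at h1
    linear_combination (f * g * f ^ β * g ^ γ * Q) * h1 + (X * g * X ^ α * g ^ γ * Q) * h2
      + (X * f * X ^ α * f ^ β * Q) * h3

/-- The span of the monomials `X ^ (r i + s j)` with `i < a`, `j < b`. -/
noncomputable def monomialSpan (K : Type*) [Field K] (r s a b : ℕ) : Submodule K K[X] :=
  Submodule.span K (Set.range fun ij : Fin a × Fin b => (X : K[X]) ^ (r * ij.1 + s * ij.2 : ℕ))

theorem X_pow_mem_monomialSpan {r s a b i j : ℕ} (hi : i < a) (hj : j < b) :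
    (X : K[X]) ^ (r * i + s * j) ∈ monomialSpan K r s a b :=
  Submodule.subset_span ⟨(⟨i, hi⟩, ⟨j, hj⟩), rfl⟩

theorem finrank_monomialSpan_le (r s a b : ℕ) :
    Module.finrank K (monomialSpan K r s a b) ≤ a * b := by
  refine (finrank_range_le_card _).trans ?_
  simp

instance monomialSpan.finiteDimensional (r s a b : ℕ) :
    FiniteDimensional K (monomialSpan K r s a b) :=
  FiniteDimensional.span_of_finite K (Set.finite_range _)

theorem twistedDerivation_mem {r s a b : ℕ} (z u v : K) (α β γ : ℕ) {q : K[X]}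
    (hq : q ∈ monomialSpan K r s a b) :
    twistedDerivation (1 - C z * X ^ r) (C u + C v * X ^ s) α β γ q ∈
      monomialSpan K r s (a + 1) (b + 1) := by
  rw [monomialSpan] at hq
  induction hq using Submodule.span_induction with
  | zero => simp
  | add x y _ _ hx hy => rw [map_add]; exact add_mem hx hy
  | smul c x _ hx => rw [map_smul]; exact Submodule.smul_mem _ _ hx
  | mem x hx =>
    obtain ⟨⟨⟨i, hi⟩, ⟨j, hj⟩⟩, rfl⟩ := hx
    simp only
    set e := r * i + s * j with he
    have hX : ∀ n : ℕ, X * derivative ((X : K[X]) ^ n) = C (n : K) * X ^ n := by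
      intro n; have := X_mul_derivative_pow (X : K[X]) n; simpa using this
    have h : twistedDerivation (1 - C z * X ^ r) (C u + C v * X ^ s) α β γ (X ^ e) =
        (((α + e) * u : K)) • (X : K[X]) ^ (r * i + s * j)
        + (((-(α + e + β * r)) * z * u : K)) • (X : K[X]) ^ (r * (i + 1) + s * j)
        + (((α + e + γ * s) * v : K)) • (X : K[X]) ^ (r * i + s * (j + 1))
        + (((-(α + e + β * r + γ * s)) * z * v : K)) •
            (X : K[X]) ^ (r * (i + 1) + s * (j + 1)) := by
      rw [twistedDerivation_apply]
      have h1 := hX r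
      have h2 := hX s
      have h3 := hX e
      have p1 : (X : K[X]) ^ (r * i + s * j) = X ^ e := rfl
      have p2 : (X : K[X]) ^ (r * (i + 1) + s * j) = X ^ e * X ^ r := by rw [he, ← pow_add]; ring_nf
      have p3 : (X : K[X]) ^ (r * i + s * (j + 1)) = X ^ e * X ^ s := by rw [he, ← pow_add]; ring_nf
      have p4 : (X : K[X]) ^ (r * (i + 1) + s * (j + 1)) = X ^ e * X ^ r * X ^ s := by
        rw [he, ← pow_add, ← pow_add]; ring_nf
      rw [p1, p2, p3, p4]
      simp only [smul_eq_C_mul, map_mul, map_add, map_neg, map_natCast, derivative_sub,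
        derivative_one, derivative_C, derivative_C_mul] at h1 h2 h3 ⊢
      linear_combination (-(β : K[X]) * C z * (C u + C v * X ^ s) * X ^ e) * h1
        + ((γ : K[X]) * C v * (1 - C z * X ^ r) * X ^ e) * h2
        + ((1 - C z * X ^ r) * (C u + C v * X ^ s)) * h3
    rw [h]
    refine add_mem (add_mem (add_mem ?_ ?_) ?_) ?_ <;>
      refine Submodule.smul_mem _ _ (X_pow_mem_monomialSpan ?_ ?_) <;> omega

theorem twistedDerivation_pow_mem {r s a b : ℕ} (z u v : K) (α β γ m : ℕ) {q : K[X]}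
    (hq : q ∈ monomialSpan K r s a b) :
    (twistedDerivation (1 - C z * X ^ r) (C u + C v * X ^ s) α β γ ^ m) q ∈
      monomialSpan K r s (a + m) (b + m) := by
  induction m with
  | zero => simpa using hq
  | succ m ih =>
    rw [pow_succ', Module.End.mul_apply]
    exact twistedDerivation_mem z u v α β γ ih

/-- In a vanishing homogeneous combination `∑ H₁ ^ b H₂ ^ (B - 1 - b) R_b`, where the prime `π`
divides `H₁` to a higher order than `H₂`, the first nonzero coefficient is divisible by a power
of `π`. -/
theorem pow_dvd_of_sum_pow_mul_pow_eq_zero {R : Type*} [CommRing R] [IsDomain R] {π h₁ h₂ : R}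
    (hπ : Prime π) (hh₁ : h₁ ≠ 0) (hh₂ : ¬ π ∣ h₂) {s e : ℕ} (hes : e ≤ s) (G : ℕ → R) {B b : ℕ}
    (hb : b < B) (hG : ∀ i < b, G i = 0)
    (h : ∑ i ∈ Finset.range B, (π ^ s * h₁) ^ i * (π ^ e * h₂) ^ (B - 1 - i) * G i = 0) :
    π ^ (s - e) ∣ G b := by
  obtain ⟨N, rfl⟩ : ∃ N, B = b + (N + 1) := ⟨B - b - 1, by omega⟩
  rw [Finset.sum_range_add, Finset.sum_eq_zero (s := Finset.range b)
    (fun i hi => by rw [hG i (Finset.mem_range.1 hi), mul_zero]), zero_add] at h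
  have hH : π ^ s * h₁ ≠ 0 := mul_ne_zero (pow_ne_zero _ hπ.ne_zero) hh₁
  have h' : ∑ i ∈ Finset.range (N + 1),
      (π ^ s * h₁) ^ i * (π ^ e * h₂) ^ (N - i) * G (b + i) = 0 := by
    refine (mul_eq_zero.1 ?_).resolve_left (pow_ne_zero b hH)
    rw [← h, Finset.mul_sum]
    refine Finset.sum_congr rfl fun i hi => ?_
    rw [show b + (N + 1) - 1 - (b + i) = N - i by omega, pow_add]
    ring
  rw [Finset.sum_range_succ'] at h'
  simp only [pow_zero, one_mul, Nat.sub_zero, add_zero] at h'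
  rcases N with _ | N
  · simp only [Finset.range_zero, Finset.sum_empty, pow_zero, one_mul, zero_add] at h'
    rw [h']; exact dvd_zero _
  have hdvd : π ^ (s + e * N) ∣ ∑ i ∈ Finset.range (N + 1),
      (π ^ s * h₁) ^ (i + 1) * (π ^ e * h₂) ^ (N + 1 - (i + 1)) * G (b + (i + 1)) := by
    refine Finset.dvd_sum fun i hi => Dvd.dvd.mul_right ?_ _
    have hi' : i ≤ N := Nat.lt_succ_iff.1 (Finset.mem_range.1 hi)
    rw [mul_pow, mul_pow, ← pow_mul, ← pow_mul]
    refine Dvd.dvd.trans ?_ (mul_dvd_mul (Dvd.intro _ rfl) (Dvd.intro _ rfl))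
    rw [← pow_add]
    refine pow_dvd_pow π ?_
    obtain ⟨j, rfl⟩ := Nat.exists_eq_add_of_le hi'
    rw [show i + j + 1 - (i + 1) = j by omega]
    nlinarith [Nat.mul_le_mul_left i hes]
  have h2 : π ^ (s + e * N) ∣ (π ^ e * h₂) ^ (N + 1) * G b := by
    rw [eq_neg_of_add_eq_zero_right h']
    exact (dvd_neg).2 hdvd
  rw [show s + e * N = e * (N + 1) + (s - e) by rw [mul_add]; omega, pow_add, mul_pow, ← pow_mul,
    mul_assoc] at h2
  have h3 := (mul_dvd_mul_iff_left (pow_ne_zero _ hπ.ne_zero)).1 h2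
  exact hπ.pow_dvd_of_dvd_mul_left _ (fun h => hh₂ (hπ.dvd_of_dvd_pow h)) h3

/-- The auxiliary polynomial of Stepanov's method for the equation
`f ^ s g ^ γ₁ = c X ^ α₂ g ^ γ₂` on the `(p-1)`-st roots of unity. -/
noncomputable def stepanovTerm (r s α₂ γ₁ γ₂ p B : ℕ) (f g : K[X]) (b b' i j : ℕ) : K[X] :=
  X ^ ((p - 1) * b' + α₂ * (B - 1 - b)) * f ^ (s * b) * g ^ (γ₁ * b + γ₂ * (B - 1 - b)) *
    X ^ (r * i + s * j)

theorem sum_range_add_sq_lt {M : ℕ} (hM : 0 < M) :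
    ∑ m ∈ Finset.range M, (M + m) * (M + m) < 4 * M ^ 3 := by
  have h : ∀ m ∈ Finset.range M, (M + m) * (M + m) < 4 * M ^ 2 := by
    intro m hm
    have := Finset.mem_range.1 hm
    nlinarith
  refine (Finset.sum_lt_sum_of_nonempty ⟨0, by simpa using hM⟩ h).trans_le ?_
  simp only [Finset.sum_const, Finset.card_range, smul_eq_mul]
  exact le_of_eq (by ring)

/-- The coefficients of Stepanov's auxiliary polynomial exist by counting. -/
theorem exists_stepanov_coeff (r s α₂ γ₁ γ₂ p B B' M : ℕ) (z u v c : K) (hM : 0 < M)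
    (hB : 4 * M ≤ B * B') :
    ∃ l : Fin B × Fin B' × Fin M × Fin M → K, l ≠ 0 ∧ ∀ m < M,
      ∑ x : Fin B × Fin B' × Fin M × Fin M, l x • (c ^ (x.1 : ℕ)) •
        (twistedDerivation (1 - C z * X ^ r) (C u + C v * X ^ s)
          ((p - 1) * x.2.1 + α₂ * (B - 1 - x.1)) (s * x.1) (γ₁ * x.1 + γ₂ * (B - 1 - x.1)) ^ m)
          (X ^ (r * x.2.2.1 + s * x.2.2.2 : ℕ)) = 0 := by
  let L := Fintype.linearCombination K (M := (m : Fin M) → monomialSpan K r s (M + m) (M + m))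
    (fun (x : Fin B × Fin B' × Fin M × Fin M) (m : Fin M) =>
    (⟨_, Submodule.smul_mem _ (c ^ (x.1 : ℕ)) (twistedDerivation_pow_mem (a := M) (b := M) z u v
          ((p - 1) * x.2.1 + α₂ * (B - 1 - x.1)) (s * x.1) (γ₁ * x.1 + γ₂ * (B - 1 - x.1)) m
          (X_pow_mem_monomialSpan x.2.2.1.2 x.2.2.2.2))⟩ :
      monomialSpan K r s (M + m) (M + m)))
  have hker : LinearMap.ker L ≠ ⊥ := by
    apply LinearMap.ker_ne_bot_of_finrank_lt
    rw [Module.finrank_pi_fintype, Module.finrank_fintype_fun_eq_card]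
    calc ∑ m : Fin M, Module.finrank K (monomialSpan K r s (M + m) (M + m))
        ≤ ∑ m : Fin M, (M + m) * (M + m) := Finset.sum_le_sum fun m _ => finrank_monomialSpan_le ..
      _ = ∑ m ∈ Finset.range M, (M + m) * (M + m) :=
        Fin.sum_univ_eq_sum_range (fun m => (M + m) * (M + m)) M
      _ < 4 * M ^ 3 := sum_range_add_sq_lt hM
      _ = 4 * M * (M * M) := by ring
      _ ≤ B * B' * (M * M) := Nat.mul_le_mul_right _ hB
      _ = _ := by simp; ring
  obtain ⟨l, hl, hl0⟩ := Submodule.exists_mem_ne_zero_of_ne_bot hker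
  refine ⟨l, hl0, fun m hm => ?_⟩
  have h1 := congrFun (LinearMap.mem_ker.1 hl) ⟨m, hm⟩
  have h2 := congrArg (Subtype.val) h1
  simpa [L, Fintype.linearCombination_apply] using h2

theorem stepanov_sum_ne_zero {p r s α₂ γ₁ γ₂ B B' M e : ℕ} [CharP K p] {f g h₁ h₂ : K[X]} {ρ : K}
    (hρ : ρ ≠ 0) (hes : e ≤ s) (hh₁ : h₁ ≠ 0) (hh₂ : h₂.eval ρ ≠ 0)
    (hH₁ : f ^ s * g ^ γ₁ = (X - C ρ) ^ s * h₁)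
    (hH₂ : X ^ α₂ * g ^ γ₂ = (X - C ρ) ^ e * h₂)
    (hM : M * M * B' ≤ s - e)
    (hinj : Function.Injective fun x : Fin B' × Fin M × Fin M =>
      ((r * x.2.1 + s * x.2.2 + (p - 1) * x.1 : ℕ) : K))
    {l : Fin B × Fin B' × Fin M × Fin M → K} (hl : l ≠ 0) :
    ∑ x, C (l x) * stepanovTerm r s α₂ γ₁ γ₂ p B f g x.1 x.2.1 x.2.2.1 x.2.2.2 ≠ 0 := by
  intro h0
  apply hl
  let G : ℕ → K[X] := fun b => if hb : b < B then
    ∑ x : Fin B' × Fin M × Fin M,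
      C (l (⟨b, hb⟩, x)) * X ^ (r * x.2.1 + s * x.2.2 + (p - 1) * x.1 : ℕ) else 0
  have hsum : ∑ i ∈ Finset.range B, ((X - C ρ) ^ s * h₁) ^ i *
      ((X - C ρ) ^ e * h₂) ^ (B - 1 - i) * G i = 0 := by
    rw [← h0, Fintype.sum_prod_type, ← Fin.sum_univ_eq_sum_range
      (fun i => ((X - C ρ) ^ s * h₁) ^ i * ((X - C ρ) ^ e * h₂) ^ (B - 1 - i) * G i) B]
    refine Finset.sum_congr rfl fun b _ => ?_
    simp only [G, b.2, dif_pos]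
    rw [Finset.mul_sum]
    refine Finset.sum_congr rfl fun x _ => ?_
    rw [← hH₁, ← hH₂, stepanovTerm]
    simp only [Fin.eta, pow_add, mul_pow, ← pow_mul]
    ring
  have key : ∀ b, ∀ hb : b < B, ∀ x, l (⟨b, hb⟩, x) = 0 := by
    intro b
    induction b using Nat.strong_induction_on with
    | _ b ih =>
      intro hb x
      have hG : ∀ i < b, G i = 0 := by
        intro i hi
        simp only [G]
        split_ifs with hiB
        · exact Finset.sum_eq_zero fun x _ => by rw [ih i hi hiB x]; simp
        · rfl
      have h1 := pow_dvd_of_sum_pow_mul_pow_eq_zero (prime_X_sub_C ρ) hh₁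
        (fun h => hh₂ (dvd_iff_isRoot.1 h)) hes G hb hG hsum
      simp only [G, hb, dif_pos] at h1
      have h2 := coeff_eq_zero_of_pow_dvd_sparse _ hinj (fun x => l (⟨b, hb⟩, x)) hρ
        (N := s - e) (by simpa [mul_comm, mul_assoc, mul_left_comm] using hM) h1
      exact congrFun h2 x
  funext x
  exact key x.1 x.1.2 x.2

theorem stepanov_iterate {p r s α₂ γ₁ γ₂ B B' M : ℕ} {f g : K[X]}
    (l : Fin B × Fin B' × Fin M × Fin M → K) (m : ℕ) :
    (fun P => X * f * g * derivative P)^[m]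
      (∑ x, C (l x) * stepanovTerm r s α₂ γ₁ γ₂ p B f g x.1 x.2.1 x.2.2.1 x.2.2.2) =
    ∑ x : Fin B × Fin B' × Fin M × Fin M, C (l x) *
      (X ^ ((p - 1) * x.2.1 + α₂ * (B - 1 - x.1)) * f ^ (s * x.1) *
        g ^ (γ₁ * x.1 + γ₂ * (B - 1 - x.1)) * (twistedDerivation f g
          ((p - 1) * x.2.1 + α₂ * (B - 1 - x.1)) (s * x.1) (γ₁ * x.1 + γ₂ * (B - 1 - x.1)) ^ m)
          (X ^ (r * x.2.2.1 + s * x.2.2.2 : ℕ))) := by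
  let D : K[X] →ₗ[K] K[X] := LinearMap.mulLeft K (X * f * g) ∘ₗ derivative
  have hD : (fun P => X * f * g * derivative P) = ⇑D := rfl
  rw [hD, ← Module.End.pow_apply, map_sum]
  refine Finset.sum_congr rfl fun x _ => ?_
  rw [← smul_eq_C_mul, map_smul, smul_eq_C_mul, Module.End.pow_apply, ← hD, stepanovTerm,
    iterate_mul_derivative_eq]

theorem stepanov_bound {p r s α₂ γ₁ γ₂ B B' M e Δ : ℕ} [CharP K p] (z u v c : K)
    {f g h₁ h₂ : K[X]} (hf : f = 1 - C z * X ^ r) (hg : g = C u + C v * X ^ s) {ρ : K}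
    (hρ : ρ ≠ 0) (hes : e ≤ s) (hh₁ : h₁ ≠ 0) (hh₂ : h₂.eval ρ ≠ 0)
    (hH₁ : f ^ s * g ^ γ₁ = (X - C ρ) ^ s * h₁)
    (hH₂ : X ^ α₂ * g ^ γ₂ = (X - C ρ) ^ e * h₂)
    (hd₁ : r * s + s * γ₁ ≤ Δ) (hd₂ : α₂ + s * γ₂ ≤ Δ)
    (hM0 : 0 < M) (hMp : M ≤ p) (hB : 4 * M ≤ B * B') (hM : M * M * B' ≤ s - e)
    (hinj : Function.Injective fun x : Fin B' × Fin M × Fin M =>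
      ((r * x.2.1 + s * x.2.2 + (p - 1) * x.1 : ℕ) : K))
    (Y : Finset K) (hY : ∀ y ∈ Y, y ^ (p - 1) = 1 ∧ y ≠ 0 ∧ f.eval y ≠ 0 ∧ g.eval y ≠ 0 ∧
      (f ^ s * g ^ γ₁).eval y = c * (X ^ α₂ * g ^ γ₂).eval y) :
    Y.card * M ≤ (r + s) * (M - 1) + (p - 1) * (B' - 1) + (B - 1) * Δ := by
  obtain ⟨l, hl, hlm⟩ := exists_stepanov_coeff r s α₂ γ₁ γ₂ p B B' M z u v c hM0 hB
  set F := ∑ x, C (l x) * stepanovTerm r s α₂ γ₁ γ₂ p B f g x.1 x.2.1 x.2.2.1 x.2.2.2 with hF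
  have hF0 : F ≠ 0 := stepanov_sum_ne_zero hρ hes hh₁ hh₂ hH₁ hH₂ hM hinj hl
  have hdvd : ∀ y ∈ Y, (X - C y) ^ M ∣ F := by
    intro y hy
    obtain ⟨hy1, hy0, hyf, hyg, hyH⟩ := hY y hy
    refine pow_dvd_of_iterate_mul_derivative p (X * f * g) y ?_ M hMp F fun m hm => ?_
    · simp [hy0, hyf, hyg]
    rw [hF, stepanov_iterate, eval_finsetSum]
    have h := congrArg (eval y) (hlm m hm)
    rw [eval_finsetSum, eval_zero] at h
    rw [← mul_zero ((X ^ α₂ * g ^ γ₂).eval y ^ (B - 1)), ← h, Finset.mul_sum]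
    refine Finset.sum_congr rfl fun x _ => ?_
    rw [← hf, ← hg]
    set T := (twistedDerivation f g ((p - 1) * x.2.1 + α₂ * (B - 1 - x.1)) (s * x.1)
      (γ₁ * x.1 + γ₂ * (B - 1 - x.1)) ^ m) (X ^ (r * x.2.2.1 + s * x.2.2.2 : ℕ))
    have hb : B - 1 = x.1 + (B - 1 - x.1) := by have := x.1.2; omega
    have hpre : y ^ ((p - 1) * x.2.1 + α₂ * (B - 1 - x.1)) * f.eval y ^ (s * x.1) *
        g.eval y ^ (γ₁ * x.1 + γ₂ * (B - 1 - x.1)) =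
        c ^ (x.1 : ℕ) * ((X ^ α₂ * g ^ γ₂).eval y) ^ (B - 1) := by
      have e1 : y ^ ((p - 1) * x.2.1 + α₂ * (B - 1 - x.1)) * f.eval y ^ (s * x.1) *
        g.eval y ^ (γ₁ * x.1 + γ₂ * (B - 1 - x.1)) =
        ((f ^ s * g ^ γ₁).eval y) ^ (x.1 : ℕ) * ((X ^ α₂ * g ^ γ₂).eval y) ^ (B - 1 - x.1) := by
        simp only [eval_mul, eval_pow, eval_X, pow_add, mul_pow]
        simp only [pow_mul, hy1, one_pow]
        ring
      rw [e1, hyH]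
      conv_rhs => rw [hb, pow_add]
      rw [mul_pow]; ring
    simp only [eval_mul, eval_C, eval_pow, eval_X, smul_eq_C_mul] at hpre ⊢
    linear_combination (l x * T.eval y) * hpre
  have hprod : ∏ y ∈ Y, (X - C y) ^ M ∣ F := by
    refine Finset.prod_dvd_of_coprime (fun a _ b _ hab => ?_) hdvd
    exact (isCoprime_X_sub_C_of_isUnit_sub (sub_ne_zero.2 hab).isUnit).pow
  have hdeg := natDegree_le_of_dvd hprod hF0
  have hdl : (∏ y ∈ Y, (X - C y) ^ M).natDegree = Y.card * M := by
    rw [natDegree_prod_of_monic _ _ fun y _ => (monic_X_sub_C y).pow M]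
    simp
  rw [hdl] at hdeg
  refine hdeg.trans ?_
  rw [hF]
  refine natDegree_sum_le_of_forall_le _ _ fun x _ => ?_
  refine (natDegree_C_mul_le _ _).trans ?_
  have hfd : f.natDegree ≤ r := by
    rw [hf]
    exact (natDegree_sub_le_of_le (natDegree_one.le.trans (Nat.zero_le r))
      (natDegree_C_mul_X_pow_le z r)).trans (by simp)
  have hgd : g.natDegree ≤ s := by
    rw [hg]
    exact (natDegree_add_le_of_le ((natDegree_C u).le.trans (Nat.zero_le s))
      (natDegree_C_mul_X_pow_le v s)).trans (by simp)
  have e1 : (stepanovTerm r s α₂ γ₁ γ₂ p B f g x.1 x.2.1 x.2.2.1 x.2.2.2).natDegree ≤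
      ((p - 1) * x.2.1 + α₂ * (B - 1 - x.1)) + (s * x.1) * r +
      (γ₁ * x.1 + γ₂ * (B - 1 - x.1)) * s + (r * x.2.2.1 + s * x.2.2.2) := by
    rw [stepanovTerm]
    refine natDegree_mul_le_of_le (natDegree_mul_le_of_le (natDegree_mul_le_of_le ?_ ?_) ?_) ?_
    · exact natDegree_X_pow_le _
    · exact natDegree_pow_le_of_le _ hfd
    · exact natDegree_pow_le_of_le _ hgd
    · exact natDegree_X_pow_le _
  refine e1.trans ?_
  obtain ⟨⟨b, hb⟩, ⟨b', hb'⟩, ⟨i, hi⟩, ⟨j, hj⟩⟩ := x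
  simp only
  have q1 : (p - 1) * b' ≤ (p - 1) * (B' - 1) := Nat.mul_le_mul_left _ (by omega)
  have q2 : r * i ≤ r * (M - 1) := Nat.mul_le_mul_left _ (by omega)
  have q3 : s * j ≤ s * (M - 1) := Nat.mul_le_mul_left _ (by omega)
  obtain ⟨w, hw⟩ : ∃ w, B - 1 - b = w := ⟨_, rfl⟩
  have hbw : B - 1 = b + w := by omega
  rw [hw, hbw]
  have q4 := Nat.mul_le_mul_right b hd₁
  have q5 := Nat.mul_le_mul_right w hd₂
  nlinarith

end StepanovMethod

section StepanovParameters

theorem Nat.injective_digits_cast {K : Type*} [CommRing K] {p r s B' M : ℕ} [CharP K p]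
    (hp : 0 < p) (h1 : M * r + B' ≤ s) (h2 : B' ≤ r) (h3 : (r + s) * M < p) :
    Function.Injective fun x : Fin B' × Fin M × Fin M =>
      ((r * x.2.1 + s * x.2.2 + (p - 1) * x.1 : ℕ) : K) := by
  rintro ⟨⟨c, hc⟩, ⟨i, hi⟩, ⟨j, hj⟩⟩ ⟨⟨c', hc'⟩, ⟨i', hi'⟩, ⟨j', hj'⟩⟩ h
  simp only [Prod.mk.injEq, Fin.mk.injEq] at h ⊢
  have hcast : ((((r * i + s * j - c : ℤ) - (r * i' + s * j' - c')) : ℤ) : K) = 0 := by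
    have hp0 : (p : K) = 0 := CharP.cast_eq_zero K p
    push_cast [Nat.cast_sub (show 1 ≤ p from hp)] at h ⊢
    rw [hp0] at h
    linear_combination h
  rw [CharP.intCast_eq_zero_iff K p] at hcast
  have hM : 0 < M := by omega
  obtain ⟨m, rfl⟩ : ∃ m, M = m + 1 := ⟨M - 1, by omega⟩
  have bi : r * i ≤ r * m := Nat.mul_le_mul_left _ (by omega)
  have bi' : r * i' ≤ r * m := Nat.mul_le_mul_left _ (by omega)
  have bj : s * j ≤ s * m := Nat.mul_le_mul_left _ (by omega)
  have bj' : s * j' ≤ s * m := Nat.mul_le_mul_left _ (by omega)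
  have h1' : m * r + r + B' ≤ s := by rw [add_mul, one_mul] at h1; exact h1
  have h3' : r * m + r + s * m + s < p := by
    have : (r + s) * (m + 1) = r * m + r + s * m + s := by ring
    omega
  have hmr : m * r = r * m := mul_comm _ _
  have hz := Int.eq_zero_of_abs_lt_dvd hcast (by
    rw [abs_lt]
    zify at *
    constructor <;> nlinarith)
  have hj : j = j' := by
    rcases lt_trichotomy j j' with hlt | heq | hlt
    · exfalso
      have : s * (j + 1) ≤ s * j' := Nat.mul_le_mul_left _ hlt
      zify at *
      nlinarith
    · exact heq
    · exfalso
      have : s * (j' + 1) ≤ s * j := Nat.mul_le_mul_left _ hlt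
      zify at *
      nlinarith
  subst hj
  have hi : i = i' := by
    rcases lt_trichotomy i i' with hlt | heq | hlt
    · exfalso
      have : r * (i + 1) ≤ r * i' := Nat.mul_le_mul_left _ hlt
      zify at *
      nlinarith
    · exact heq
    · exfalso
      have : r * (i' + 1) ≤ r * i := Nat.mul_le_mul_left _ hlt
      zify at *
      nlinarith
  subst hi
  refine ⟨?_, rfl, rfl⟩
  zify
  linarith

set_option maxHeartbeats 1600000 in
/-- Admissible parameters for Stepanov's method when `p = t ^ 80`. -/
theorem exists_stepanov_parameters {p r s : ℕ} {t : ℝ} (ht : 70 ≤ t) (hp : (p : ℝ) = t ^ 80)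
    (hr : (r : ℝ) ≤ t ^ 23) (hs : (s : ℝ) ≤ t ^ 57) (hrs : 2 * t ^ 69 < (r : ℝ) * s) :
    ∃ M B B' : ℕ, 0 < M ∧ M ≤ p ∧ 4 * M ≤ B * B' ∧ M * M * B' + r ≤ s ∧ M * r + B' ≤ s ∧ B' ≤ r ∧
      (r + s) * M < p ∧ ((((r + s) * (M - 1) + (p - 1) * (B' - 1) + (B - 1) * (2 * (r * s)) : ℕ) :
        ℝ) ≤ 4.01 * t ^ 69 * M) := by
  have ht0 : (0 : ℝ) < t := by linarith
  have P : ∀ n : ℕ, (0 : ℝ) < t ^ n := fun n => pow_pos ht0 n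
  have hr0 : (0 : ℝ) ≤ r := Nat.cast_nonneg r
  have hs0 : (0 : ℝ) ≤ s := Nat.cast_nonneg s
  have hr2 : 2 * t ^ 12 < r := by
    by_contra! h
    have : (r : ℝ) * s ≤ 2 * t ^ 12 * t ^ 57 := mul_le_mul h hs hs0 (by positivity)
    nlinarith [show t ^ 12 * t ^ 57 = t ^ 69 by ring]
  have hs2 : 2 * t ^ 46 < s := by
    by_contra! h
    have : (r : ℝ) * s ≤ t ^ 23 * (2 * t ^ 46) := mul_le_mul hr h hs0 (by positivity)
    nlinarith [show t ^ 23 * (2 * t ^ 46) = 2 * t ^ 69 by ring]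
  set q : ℝ := 2 * (r * s) / t ^ 58 with hq
  have hq1 : 4 * t ^ 11 < q := by
    rw [hq, lt_div_iff₀ (P 58)]; nlinarith [show t ^ 11 * t ^ 58 = t ^ 69 by ring]
  have hqm : q * t ^ 58 = 2 * (r * s) := div_mul_cancel₀ _ (P 58).ne'
  have t11 : (1000 : ℝ) ≤ t ^ 11 := by
    calc (1000 : ℝ) ≤ 70 ^ 11 := by norm_num
      _ ≤ t ^ 11 := pow_le_pow_left₀ (by norm_num) ht 11
  set M := ⌈q⌉₊ with hM
  have hMq : q ≤ M := Nat.le_ceil q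
  have hMq' : (M : ℝ) ≤ 1.01 * q := by
    have := (Nat.ceil_lt_add_one (by linarith [P 11] : 0 ≤ q)).le
    rw [← hM] at this
    nlinarith
  have hMt : 4 * t ^ 11 < M := hq1.trans_le hMq
  set w : ℝ := 2 * M / t ^ 11 with hw
  have hwm : w * t ^ 11 = 2 * M := div_mul_cancel₀ _ (P 11).ne'
  have hw8 : 8 < w := by rw [hw, lt_div_iff₀ (P 11)]; linarith
  set B' := ⌈w⌉₊ with hB'
  have hBw : w ≤ B' := Nat.le_ceil w
  have hBw1 : (B' : ℝ) ≤ w + 1 := (Nat.ceil_lt_add_one (by linarith)).le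
  set B := ⌈2 * t ^ 11⌉₊ with hB
  have hBt : 2 * t ^ 11 ≤ B := Nat.le_ceil _
  have hBt1 : (B : ℝ) ≤ 2 * t ^ 11 + 1 := (Nat.ceil_lt_add_one (by positivity)).le
  have hM0' : (0 : ℝ) < M := by linarith [P 11]
  have hM0 : 0 < M := by exact_mod_cast hM0'
  have hB0 : 0 < B := by have : (0 : ℝ) < B := by linarith
                         exact_mod_cast this
  have hB'0 : 0 < B' := by have : (0 : ℝ) < B' := by linarith
                           exact_mod_cast this
  -- upper bounds for `M`
  have hMr : (M : ℝ) * t ≤ 2.02 * r := by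
    have h1 : (M : ℝ) * t * t ^ 57 ≤ 2.02 * r * t ^ 57 := by
      calc (M : ℝ) * t * t ^ 57 = M * t ^ 58 := by ring
        _ ≤ 1.01 * q * t ^ 58 := by gcongr
        _ = 2.02 * r * s := by rw [mul_assoc, hqm]; ring
        _ ≤ 2.02 * r * t ^ 57 := by gcongr
    exact le_of_mul_le_mul_right h1 (P 57)
  have hMs : (M : ℝ) * t ^ 35 ≤ 2.02 * s := by
    have h1 : (M : ℝ) * t ^ 35 * t ^ 23 ≤ 2.02 * s * t ^ 23 := by
      calc (M : ℝ) * t ^ 35 * t ^ 23 = M * t ^ 58 := by ring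
        _ ≤ 1.01 * q * t ^ 58 := by gcongr
        _ = 2.02 * s * r := by rw [mul_assoc, hqm]; ring
        _ ≤ 2.02 * s * t ^ 23 := by gcongr
    exact le_of_mul_le_mul_right h1 (P 23)
  have hMt22 : (M : ℝ) ≤ 2.02 * t ^ 22 := by
    have h1 : (M : ℝ) * t ≤ 2.02 * t ^ 22 * t := by
      calc (M : ℝ) * t ≤ 2.02 * r := hMr
        _ ≤ 2.02 * t ^ 23 := by gcongr
        _ = _ := by ring
    exact le_of_mul_le_mul_right h1 ht0
  have hMr' : (M : ℝ) ≤ 0.03 * r := by nlinarith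
  have hB'M : (B' : ℝ) ≤ M := by
    have : w ≤ 0.002 * M := by
      rw [hw, div_le_iff₀ (P 11)]; nlinarith
    nlinarith
  have hrs' : (r : ℝ) ≤ 0.001 * s := by
    have : (1000 : ℝ) * t ^ 23 ≤ t ^ 46 := by
      have h23 : (1000 : ℝ) ≤ t ^ 23 := by
        calc (1000 : ℝ) ≤ 70 ^ 23 := by norm_num
          _ ≤ t ^ 23 := pow_le_pow_left₀ (by norm_num) ht 23
      calc (1000 : ℝ) * t ^ 23 ≤ t ^ 23 * t ^ 23 := by gcongr
        _ = t ^ 46 := by ring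
    linarith
  have c1 : 4 * M ≤ B * B' := by
    have : (4 * M : ℝ) ≤ B * B' := by
      calc (4 * M : ℝ) = (2 * t ^ 11) * w := by linarith
        _ ≤ B * B' := by gcongr
    exact_mod_cast this
  have c2 : M * M * B' + r ≤ s := by
    have h1 : (M * M * B' : ℝ) ≤ 0.01 * s := by
      have hB'w : (B' : ℝ) * t ^ 11 ≤ 2.25 * M := by nlinarith
      have hMM : (M * M : ℝ) ≤ 4.1 * t ^ 44 := by
        calc (M * M : ℝ) ≤ (2.02 * t ^ 22) * (2.02 * t ^ 22) := by gcongr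
          _ = 4.0804 * t ^ 44 := by ring
          _ ≤ 4.1 * t ^ 44 := by nlinarith [P 44]
      have h2 : (M * M * B' : ℝ) * t ^ 46 ≤ 18.7 * s * t ^ 44 := by
        calc (M * M * B' : ℝ) * t ^ 46 = (M * M) * (B' * t ^ 11) * t ^ 35 := by ring
          _ ≤ (4.1 * t ^ 44) * (2.25 * M) * t ^ 35 := by gcongr
          _ = 9.225 * t ^ 44 * (M * t ^ 35) := by ring
          _ ≤ 9.225 * t ^ 44 * (2.02 * s) := by gcongr
          _ = 18.6345 * s * t ^ 44 := by ring
          _ ≤ 18.7 * s * t ^ 44 := by gcongr; norm_num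
      have h3 : (M * M * B' : ℝ) * t ^ 2 ≤ 18.7 * s := by
        refine le_of_mul_le_mul_right ?_ (P 44)
        calc _ = (M * M * B' : ℝ) * t ^ 46 := by ring
          _ ≤ _ := h2
      have h4 : (4900 : ℝ) ≤ t ^ 2 := by nlinarith
      have h5 : (0 : ℝ) ≤ M * M * B' := by positivity
      nlinarith
    have : (M * M * B' + r : ℝ) ≤ s := by linarith
    exact_mod_cast this
  have c3 : M * r + B' ≤ s := by
    have h1 : (M * r : ℝ) ≤ 0.02 * s := by
      have : (M * r : ℝ) * t ≤ 2.02 * t ^ 46 := by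
        calc (M * r : ℝ) * t = (M * t) * r := by ring
          _ ≤ (2.02 * r) * r := by gcongr
          _ ≤ (2.02 * t ^ 23) * t ^ 23 := by gcongr
          _ = _ := by ring
      have h5 : (0 : ℝ) ≤ M * r := by positivity
      nlinarith
    have : (M * r + B' : ℝ) ≤ s := by linarith
    exact_mod_cast this
  have c4 : B' ≤ r := by
    have : (B' : ℝ) ≤ r := by linarith
    exact_mod_cast this
  have c5 : (r + s) * M < p := by
    have : ((r + s) * M : ℝ) < p := by
      rw [hp]
      calc ((r + s) * M : ℝ) ≤ (1.001 * s) * M := by gcongr; linarith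
        _ ≤ (1.001 * t ^ 57) * (2.02 * t ^ 22) := by gcongr
        _ = 2.02202 * t ^ 79 := by ring
        _ < 70 * t ^ 79 := by nlinarith [P 79]
        _ ≤ t * t ^ 79 := by gcongr
        _ = t ^ 80 := by ring
    exact_mod_cast this
  have hspos : 0 < s := by have : (0 : ℝ) < s := by linarith [P 46]
                           exact_mod_cast this
  refine ⟨M, B, B', hM0, ?_, c1, c2, c3, c4, c5, ?_⟩
  · exact (Nat.le_mul_of_pos_left M (by omega)).trans c5.le
  have hp0 : 0 < p := by omega
  push_cast [Nat.cast_sub (show 1 ≤ M from hM0), Nat.cast_sub (show 1 ≤ B from hB0),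
    Nat.cast_sub (show 1 ≤ B' from hB'0), Nat.cast_sub (show 1 ≤ p from hp0)]
  have e1 : ((r + s) * (M - 1) : ℝ) ≤ 0.01 * t ^ 69 * M := by
    have : (r + s : ℝ) ≤ 0.01 * t ^ 69 := by
      calc (r + s : ℝ) ≤ 2 * t ^ 57 := by linarith
        _ ≤ 0.01 * (1000 * t ^ 57) := by nlinarith [P 57]
        _ ≤ 0.01 * (t ^ 11 * t ^ 57) := by gcongr
        _ = 0.01 * t ^ 68 := by ring
        _ ≤ 0.01 * t ^ 69 := by
          gcongr
          · linarith
          · norm_num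
    calc ((r + s) * (M - 1) : ℝ) ≤ (r + s) * M := by gcongr; linarith
      _ ≤ _ := by gcongr
  have e2 : ((p - 1) * (B' - 1) : ℝ) ≤ 2 * t ^ 69 * M := by
    have hp1 : (1 : ℝ) ≤ p := by exact_mod_cast hp0
    calc ((p - 1) * (B' - 1) : ℝ) ≤ p * w := by
          apply mul_le_mul <;> linarith [show (1 : ℝ) ≤ B' by linarith]
      _ = t ^ 69 * (w * t ^ 11) := by rw [hp]; ring
      _ = _ := by rw [hwm]; ring
  have e3 : ((B - 1) * (2 * (r * s)) : ℝ) ≤ 2 * t ^ 69 * M := by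
    calc ((B - 1) * (2 * (r * s)) : ℝ) ≤ (2 * t ^ 11) * (M * t ^ 58) := by
          have : (2 * (r * s) : ℝ) ≤ M * t ^ 58 := by
            rw [← hqm]; exact mul_le_mul_of_nonneg_right hMq (P 58).le
          refine mul_le_mul (by linarith) this (by positivity) (by positivity)
      _ = _ := by ring
  linarith

end StepanovParameters

section StepanovCount

open Polynomial

variable {K : Type*} [Field K]

theorem stepanov_card_le {p r s α₂ γ₁ γ₂ e : ℕ} {t : ℝ} [CharP K p] (ht : 70 ≤ t)
    (hp : (p : ℝ) = t ^ 80) (hr : (r : ℝ) ≤ t ^ 23) (hs : (s : ℝ) ≤ t ^ 57) (z u v c : K)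
    {f g h₁ h₂ : K[X]} (hf : f = 1 - C z * X ^ r) (hg : g = C u + C v * X ^ s) {ρ : K}
    (hρ : ρ ≠ 0) (her : e ≤ r) (hh₁ : h₁ ≠ 0) (hh₂ : h₂.eval ρ ≠ 0)
    (hH₁ : f ^ s * g ^ γ₁ = (X - C ρ) ^ s * h₁)
    (hH₂ : X ^ α₂ * g ^ γ₂ = (X - C ρ) ^ e * h₂)
    (hd₁ : r * s + s * γ₁ ≤ 2 * (r * s)) (hd₂ : α₂ + s * γ₂ ≤ 2 * (r * s))
    (hne : f ^ s * g ^ γ₁ - C c * (X ^ α₂ * g ^ γ₂) ≠ 0)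
    (Y : Finset K) (hY : ∀ y ∈ Y, y ^ (p - 1) = 1 ∧ y ≠ 0 ∧ f.eval y ≠ 0 ∧ g.eval y ≠ 0 ∧
      (f ^ s * g ^ γ₁).eval y = c * (X ^ α₂ * g ^ γ₂).eval y) :
    (Y.card : ℝ) ≤ 4.01 * t ^ 69 := by
  have ht0 : (0 : ℝ) < t := by linarith
  have hfd : f.natDegree ≤ r := by
    rw [hf]
    exact (natDegree_sub_le_of_le (natDegree_one.le.trans (Nat.zero_le r))
      (natDegree_C_mul_X_pow_le z r)).trans (by simp)
  have hgd : g.natDegree ≤ s := by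
    rw [hg]
    exact (natDegree_add_le_of_le ((natDegree_C u).le.trans (Nat.zero_le s))
      (natDegree_C_mul_X_pow_le v s)).trans (by simp)
  rcases le_or_gt ((r : ℝ) * s) (2 * t ^ 69) with hsmall | hbig
  · have h1 : Y.card ≤ 2 * (r * s) := by
      have h2 : Y.val ≤ (f ^ s * g ^ γ₁ - C c * (X ^ α₂ * g ^ γ₂)).roots := by
        refine (Multiset.le_iff_subset Y.nodup).2 fun y hy => ?_
        rw [mem_roots hne, IsRoot.def, eval_sub, eval_mul (p := C c), eval_C,
          (hY y hy).2.2.2.2, sub_self]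
      refine (Multiset.card_le_card h2).trans ((card_roots' _).trans ?_)
      refine (natDegree_sub_le_of_le (n := 2 * (r * s)) (m := 2 * (r * s)) ?_ ?_).trans
        (max_self _).le
      · refine (natDegree_mul_le_of_le (natDegree_pow_le_of_le _ hfd)
          (natDegree_pow_le_of_le _ hgd)).trans ?_
        nlinarith
      · refine (natDegree_C_mul_le _ _).trans ((natDegree_mul_le_of_le (natDegree_X_pow_le _)
          (natDegree_pow_le_of_le _ hgd)).trans ?_)
        nlinarith
    have h2 : (Y.card : ℝ) ≤ 2 * (r * s) := by exact_mod_cast h1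
    linarith [pow_pos ht0 69]
  · obtain ⟨M, B, B', hM0, hMp, hB, hM, h3, h4, h5, h6⟩ :=
      exists_stepanov_parameters ht hp hr hs hbig
    have h7 := stepanov_bound z u v c hf hg hρ (by omega) hh₁ hh₂ hH₁ hH₂ hd₁ hd₂ hM0 hMp hB
      (by omega) (Nat.injective_digits_cast (by omega) h3 h4 h5) Y hY
    have h8 : ((Y.card * M : ℕ) : ℝ) ≤ 4.01 * t ^ 69 * M := le_trans (by exact_mod_cast h7) h6
    push_cast at h8
    exact le_of_mul_le_mul_right h8 (by exact_mod_cast hM0)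

theorem exists_eq_X_sub_C_mul [IsAlgClosed K] {r : ℕ} (hr : 0 < r) {z : K} (hz : z ≠ 0) :
    ∃ ρ : K, ρ ≠ 0 ∧ ∃ f₁ : K[X], f₁ ≠ 0 ∧ 1 - C z * X ^ r = (X - C ρ) * f₁ := by
  obtain ⟨ρ, hρ⟩ := IsAlgClosed.exists_pow_nat_eq z⁻¹ hr
  refine ⟨ρ, ?_, ?_⟩
  · rintro rfl
    rw [zero_pow hr.ne'] at hρ
    exact inv_ne_zero hz hρ.symm
  · have h : (1 - C z * X ^ r : K[X]).IsRoot ρ := by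
      simp [IsRoot.def, hρ, hz]
    obtain ⟨f₁, hf₁⟩ := dvd_iff_isRoot.2 h
    refine ⟨f₁, ?_, hf₁⟩
    rintro rfl
    have := congrArg (eval 0) hf₁
    simp [hr.ne'] at this

theorem one_sub_pow_ne {p r s : ℕ} [CharP K p] (hr0 : 0 < r) (hs0 : 0 < s) (hrp : r < p)
    (hsp : s < p) (hrs : r ≠ s) {z v : K} (hz : z ≠ 0) (hv : v ≠ 0) (c : K) :
    (1 - C z * X ^ r) ^ s ≠ C c * (1 - C v * X ^ s) ^ r := by
  intro h
  have hrK : (r : K) ≠ 0 := by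
    rw [Ne, CharP.cast_eq_zero_iff K p]; exact Nat.not_dvd_of_pos_of_lt hr0 hrp
  have hsK : (s : K) ≠ 0 := by
    rw [Ne, CharP.cast_eq_zero_iff K p]; exact Nat.not_dvd_of_pos_of_lt hs0 hsp
  have hc : c = 1 := by
    have := congrArg (eval 0) h
    simpa [hr0.ne', hs0.ne', eq_comm] using this
  subst hc
  obtain ⟨r, rfl⟩ := Nat.exists_eq_add_one_of_ne_zero hr0.ne'
  obtain ⟨s, rfl⟩ := Nat.exists_eq_add_one_of_ne_zero hs0.ne'
  have hd := congrArg derivative h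
  simp only [map_one, one_mul, derivative_pow, derivative_sub, derivative_one,
    derivative_C_mul, derivative_X, Nat.add_sub_cancel, mul_one, zero_sub] at hd
  have hC : (C ((r + 1 : ℕ) : K) * C ((s + 1 : ℕ) : K)) ≠ 0 := by
    rw [← C_mul]; exact C_ne_zero.2 (mul_ne_zero hrK hsK)
  have h1 : C z * X ^ r * (1 - C z * X ^ (r + 1)) ^ s =
      C v * X ^ s * (1 - C v * X ^ (s + 1)) ^ r := by
    apply mul_left_cancel₀ hC
    linear_combination -hd
  have hX : ∀ n : ℕ, (X : K[X]) ^ n ≠ 0 := fun n => pow_ne_zero n X_ne_zero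
  rcases lt_or_gt_of_ne (show r ≠ s by omega) with hlt | hlt
  · obtain ⟨w, rfl⟩ : ∃ w, s = r + (w + 1) := ⟨s - r - 1, by omega⟩
    have h2 : C z * (1 - C z * X ^ (r + 1)) ^ (r + (w + 1)) =
        C v * X ^ (w + 1) * (1 - C v * X ^ (r + (w + 1) + 1)) ^ r := by
      apply mul_left_cancel₀ (hX r)
      linear_combination h1
    have := congrArg (eval 0) h2
    simp at this
    exact hz this
  · obtain ⟨w, rfl⟩ : ∃ w, r = s + (w + 1) := ⟨r - s - 1, by omega⟩
    have h2 : C v * (1 - C v * X ^ (s + 1)) ^ (s + (w + 1)) =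
        C z * X ^ (w + 1) * (1 - C z * X ^ (s + (w + 1) + 1)) ^ s := by
      apply mul_left_cancel₀ (hX s)
      linear_combination -h1
    have := congrArg (eval 0) h2
    simp at this
    exact hv this

theorem card_le_of_pos_exponent [IsAlgClosed K] {p r s : ℕ} {t : ℝ} [CharP K p] (ht : 70 ≤ t)
    (hp : (p : ℝ) = t ^ 80) (hr : (r : ℝ) ≤ t ^ 23) (hs : (s : ℝ) ≤ t ^ 57) (hr0 : 0 < r)
    (hs0 : 0 < s) (hrs : r ≠ s) {z v : K} (hz : z ≠ 0) (hv : v ≠ 0) (c : K) (Y : Finset K)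
    (hY : ∀ y ∈ Y, y ^ (p - 1) = 1 ∧ y ≠ 0 ∧ 1 - z * y ^ r ≠ 0 ∧ 1 - v * y ^ s ≠ 0 ∧
      (1 - z * y ^ r) ^ s = c * (1 - v * y ^ s) ^ r) :
    (Y.card : ℝ) ≤ 4.01 * t ^ 69 := by
  have hlt : ∀ m : ℕ, m < 80 → ∀ n : ℕ, (n : ℝ) ≤ t ^ m → n < p := by
    intro m hm n hn
    have : (n : ℝ) < p := hn.trans_lt (hp ▸ pow_lt_pow_right₀ (by linarith) hm)
    exact_mod_cast this
  have hrp := hlt 23 (by norm_num) r hr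
  have hsp := hlt 57 (by norm_num) s hs
  have hsK : (s : K) ≠ 0 := by
    rw [Ne, CharP.cast_eq_zero_iff K p]; exact Nat.not_dvd_of_pos_of_lt hs0 hsp
  obtain ⟨ρ, hρ, f₁, hf₁, hf⟩ := exists_eq_X_sub_C_mul hr0 hz
  have hg : (1 - C v * X ^ s : K[X]) = C 1 + C (-v) * X ^ s := by
    rw [C_neg, C_1]; ring
  obtain ⟨e, h₂, he, hh₂, hH₂⟩ : ∃ (e : ℕ) (h₂ : K[X]), e ≤ r ∧ h₂.eval ρ ≠ 0 ∧
      X ^ 0 * (1 - C v * X ^ s : K[X]) ^ r = (X - C ρ) ^ e * h₂ := by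
    by_cases hroot : (1 - C v * X ^ s : K[X]).IsRoot ρ
    · obtain ⟨g₁, hg₁⟩ := dvd_iff_isRoot.2 hroot
      refine ⟨r, g₁ ^ r, le_rfl, ?_, ?_⟩
      · have := congrArg (fun P => eval ρ (derivative P)) hg₁
        simp [derivative_X_pow] at this
        rw [eval_pow, ← this]
        simp [hv, hsK, hρ]
      · rw [hg₁, mul_pow]; simp
    · exact ⟨0, (1 - C v * X ^ s : K[X]) ^ r, Nat.zero_le _, by
        rw [eval_pow]; exact pow_ne_zero _ hroot, by simp⟩
  refine stepanov_card_le (p := p) (α₂ := 0) (γ₁ := 0) (γ₂ := r) ht hp hr hs z 1 (-v) c rfl hg hρ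
    he (pow_ne_zero s hf₁) hh₂ (by rw [hf, mul_pow]; simp) hH₂ (by nlinarith) (by nlinarith) ?_ Y ?_
  · rw [sub_ne_zero]
    simpa using one_sub_pow_ne hr0 hs0 hrp hsp hrs hz hv c
  · intro y hy
    simpa using hY y hy

theorem card_le_of_neg_exponent [IsAlgClosed K] {p r s : ℕ} {t : ℝ} [CharP K p] (ht : 70 ≤ t)
    (hp : (p : ℝ) = t ^ 80) (hr : (r : ℝ) ≤ t ^ 23) (hs : (s : ℝ) ≤ t ^ 57) (hr0 : 0 < r)
    (hs0 : 0 < s) {z v : K} (hz : z ≠ 0) (hv : v ≠ 0) (c : K) (Y : Finset K)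
    (hY : ∀ y ∈ Y, y ^ (p - 1) = 1 ∧ y ≠ 0 ∧ 1 - z * y ^ r ≠ 0 ∧ y ^ s - v ≠ 0 ∧
      (1 - z * y ^ r) ^ s * (y ^ s - v) ^ r = c * y ^ (r * s)) :
    (Y.card : ℝ) ≤ 4.01 * t ^ 69 := by
  obtain ⟨ρ, hρ, f₁, hf₁, hf⟩ := exists_eq_X_sub_C_mul hr0 hz
  have hg : (X ^ s - C v : K[X]) = C (-v) + C 1 * X ^ s := by
    rw [C_neg, C_1]; ring
  have hg0 : (X ^ s - C v : K[X]) ≠ 0 := X_pow_sub_C_ne_zero hs0 v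
  refine stepanov_card_le (p := p) (α₂ := r * s) (γ₁ := r) (γ₂ := 0) (e := 0) (h₂ := X ^ (r * s))
    ht hp hr hs z (-v) 1 c rfl hg hρ (Nat.zero_le r) (mul_ne_zero (pow_ne_zero s hf₁)
    (pow_ne_zero r hg0)) (by simp [hρ]) (by rw [hf, mul_pow, mul_assoc]) (by simp) (by nlinarith)
    (by nlinarith) ?_ Y ?_
  · intro h
    have := congrArg (eval 0) h
    simp [hr0.ne', hs0.ne', hv] at this
  · intro y hy
    simpa using hY y hy

end StepanovCount

section FermatTypeCount

theorem Finset.exists_card_le_card_filter_mul {G : Type*} [Group G] [Fintype G] [DecidableEq G]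
    (U : Finset G) (g : G → G) : ∃ z : G, U.card ≤ (univ.filter fun y => z * g y ∈ U).card := by
  by_contra! h
  have h1 : ∑ z : G, (univ.filter fun y => z * g y ∈ U).card = ∑ _z : G, U.card := by
    have h2 : ∀ z : G, (univ.filter fun y => z * g y ∈ U).card =
        ∑ y : G, if z * g y ∈ U then 1 else 0 := fun z => by rw [card_filter]
    rw [sum_congr rfl fun z _ => h2 z, sum_comm]
    refine sum_congr rfl fun y _ => ?_
    have h4 := Equiv.sum_comp (Equiv.mulRight (g y)) 
      (fun x => if x ∈ U then (1 : ℕ) else 0)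
    simp only [Equiv.coe_mulRight] at h4
    refine h4.trans ?_
    simp
  have h3 := sum_lt_sum_of_nonempty (univ_nonempty (α := G)) fun z _ => h z
  omega

/-- Dirichlet approximation of `k / (p - 1)`. -/
theorem exists_small_multiple {p k : ℕ} {t : ℝ} (ht : 70 ≤ t) (hp : (p : ℝ) = t ^ 80)
    (hk : Nat.gcd k (p - 1) = 1) :
    ∃ (r : ℕ) (s : ℤ), 0 < r ∧ (r : ℝ) ≤ t ^ 23 ∧ s ≠ 0 ∧ |(s : ℝ)| ≤ t ^ 57 ∧
      ((p : ℤ) - 1) ∣ r * k - s := by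
  have ht0 : (0 : ℝ) < t := by linarith
  have ht1 : (1 : ℝ) ≤ t := by linarith
  have h23 : t ^ 23 + 1 < p := by
    have h1 : t ^ 23 * t ≤ t ^ 79 * t := by gcongr; norm_num
    have h2 : (1 : ℝ) ≤ t ^ 23 := one_le_pow₀ ht1
    rw [hp]
    nlinarith
  have hn : 0 < ⌊t ^ 23⌋₊ := Nat.floor_pos.2 (one_le_pow₀ ht1)
  obtain ⟨j, r, hr0, hrn, h⟩ :=
    Real.exists_int_int_abs_mul_sub_le ((k : ℝ) / ((p : ℝ) - 1)) hn
  lift r to ℕ using hr0.le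
  have hr0' : 0 < r := by exact_mod_cast hr0
  have hr : (r : ℝ) ≤ t ^ 23 := by
    have : r ≤ ⌊t ^ 23⌋₊ := by exact_mod_cast hrn
    exact (Nat.cast_le.2 this).trans (Nat.floor_le (by positivity))
  have hp1 : (0 : ℝ) < (p : ℝ) - 1 := by linarith [pow_pos ht0 23]
  refine ⟨r, r * k - j * ((p : ℤ) - 1), hr0', hr, ?_, ?_, ?_⟩
  · intro h0
    have hdvd : ((p : ℤ) - 1) ∣ r * k := ⟨j, by linarith⟩
    have hpn : 1 ≤ p := by have : (1 : ℝ) ≤ p := by linarith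
                           exact_mod_cast this
    have h1 : (p - 1) ∣ r * k := by
      zify [hpn]; exact hdvd
    have h2 : (p - 1) ∣ r := (Nat.Coprime.symm hk).dvd_of_dvd_mul_right h1
    have h3 := Nat.le_of_dvd hr0' h2
    have h4 : (p : ℝ) ≤ r + 1 := by
      have : p ≤ r + 1 := by omega
      exact_mod_cast this
    linarith
  · push_cast at h ⊢
    have h1 : (r : ℝ) * k - j * (p - 1) = (r * (k / (p - 1)) - j) * (p - 1) := by
      field_simp
    rw [h1, abs_mul, abs_of_pos hp1]
    have h2 : t ^ 23 ≤ (⌊t ^ 23⌋₊ : ℝ) + 1 := (Nat.lt_floor_add_one _).le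
    calc _ ≤ 1 / ((⌊t ^ 23⌋₊ : ℝ) + 1) * ((p : ℝ) - 1) := by gcongr
      _ ≤ 1 / t ^ 23 * (t ^ 80) := by
        rw [← hp]; gcongr; linarith
      _ = t ^ 57 := by field_simp
  · exact ⟨j, by ring⟩

theorem ZMod.pow_eq_pow_of_sub_dvd {p : ℕ} [Fact p.Prime] {x : ZMod p} (hx : x ≠ 0) {a b : ℕ}
    (h : ((p : ℤ) - 1) ∣ a - b) : x ^ a = x ^ b := by
  have hp := (Fact.out : p.Prime).one_lt
  have h1 : a ≡ b [MOD p - 1] := by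
    refine (Nat.modEq_iff_dvd.2 ?_).symm
    rwa [Nat.cast_sub hp.le, Nat.cast_one]
  rw [pow_eq_pow_mod a (ZMod.pow_card_sub_one_eq_one hx),
    pow_eq_pow_mod b (ZMod.pow_card_sub_one_eq_one hx), h1]

open Classical in
theorem card_filter_one_sub_pow_le {p k : ℕ} [Fact p.Prime] {t : ℝ} (ht : 70 ≤ t)
    (hp : (p : ℝ) = t ^ 80) (hk1 : 1 ≤ k) (hk : Nat.gcd k (p - 1) = 1)
    (hord : ∀ r : ℕ, 0 < r → (r : ℝ) ≤ t ^ 23 → ¬ (p - 1) ∣ r * (k - 1)) (c : ZMod p) :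
    ((Finset.univ.filter fun u : (ZMod p)ˣ =>
      (1 - u : ZMod p) ≠ 0 ∧ (1 - (u : ZMod p) ^ k) ≠ 0 ∧
        (1 - (u : ZMod p) ^ k) = c * (1 - u) ^ k).card : ℝ) ≤ 4.01 * t ^ 69 := by
  obtain ⟨r, s, hr0, hr, hs0, hs, hdvd⟩ := exists_small_multiple ht hp hk
  set U := Finset.univ.filter fun u : (ZMod p)ˣ =>
      (1 - u : ZMod p) ≠ 0 ∧ (1 - (u : ZMod p) ^ k) ≠ 0 ∧
        (1 - (u : ZMod p) ^ k) = c * (1 - u) ^ k with hU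
  obtain ⟨z, hz⟩ := Finset.exists_card_le_card_filter_mul U (fun y => y ^ r)
  set V := Finset.univ.filter fun y : (ZMod p)ˣ => z * y ^ r ∈ U with hV
  have hmem : ∀ y ∈ V, (1 - z * y ^ r : ZMod p) ≠ 0 ∧ (1 - (z * y ^ r : ZMod p) ^ k) ≠ 0 ∧
      (1 - (z * y ^ r : ZMod p) ^ k) = c * (1 - z * y ^ r) ^ k := by
    intro y hy
    simpa [hV, hU] using hy
  have hp1 := (Fact.out : p.Prime).one_lt
  let K := AlgebraicClosure (ZMod p)
  have : CharP K p := charP_of_injective_algebraMap (algebraMap (ZMod p) K).injective p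
  let φ := algebraMap (ZMod p) K
  have hφ : Function.Injective φ := φ.injective
  have hφi : Function.Injective fun y : (ZMod p)ˣ => φ y := hφ.comp Units.val_injective
  refine (Nat.cast_le.2 hz).trans ?_
  rw [← Finset.card_image_of_injective V hφi]
  have hz0 : φ z ≠ 0 := (map_ne_zero φ).2 z.ne_zero
  have hfacts : ∀ y : (ZMod p)ˣ, φ y ^ (p - 1) = 1 ∧ φ y ≠ 0 := fun y =>
    ⟨by rw [← map_pow, ZMod.pow_card_sub_one_eq_one y.ne_zero, map_one],
      (map_ne_zero φ).2 y.ne_zero⟩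
  rcases lt_or_gt_of_ne hs0 with hneg | hpos
  · obtain ⟨s', rfl⟩ : ∃ s' : ℕ, s = -s' := ⟨s.natAbs, by omega⟩
    have hs' : (s' : ℝ) ≤ t ^ 57 := by
      have := hs; push_cast at this; rwa [abs_neg, abs_of_nonneg (Nat.cast_nonneg s')] at this
    have hone : ∀ x : ZMod p, x ≠ 0 → x ^ (r * k) * x ^ s' = 1 := by
      intro x hx
      rw [← pow_add, ← pow_zero x]
      refine ZMod.pow_eq_pow_of_sub_dvd hx ?_
      push_cast
      simpa using hdvd
    refine card_le_of_neg_exponent ht hp hr hs' hr0 (by omega) hz0 (v := φ (z ^ k))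
      ((map_ne_zero φ).2 (pow_ne_zero k z.ne_zero)) (φ (c ^ r)) _ ?_
    intro y' hy'
    obtain ⟨y, hy, rfl⟩ := Finset.mem_image.1 hy'
    obtain ⟨h1, h2, h3⟩ := hmem y hy
    have hyk : ((z * y ^ r : ZMod p) ^ k) * y ^ s' = z ^ k := by
      have := hone y y.ne_zero
      rw [mul_pow, ← pow_mul, mul_assoc, this, mul_one]
    have hg : (y : ZMod p) ^ s' - z ^ k = (1 - (z * y ^ r : ZMod p) ^ k) * y ^ s' := by
      rw [← hyk]; ring
    refine ⟨(hfacts y).1, (hfacts y).2, ?_, ?_, ?_⟩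
    · rw [← map_pow, ← map_mul, ← map_one φ, ← map_sub]; exact (map_ne_zero φ).2 h1
    · rw [← map_pow, ← map_sub, hg]
      exact (map_ne_zero φ).2 (mul_ne_zero h2 (pow_ne_zero _ y.ne_zero))
    · rw [← map_pow, ← map_mul, ← map_one φ, ← map_sub, ← map_pow, ← map_pow, ← map_sub, ← map_pow,
        ← map_mul, ← map_pow, ← map_mul]
      congr 1
      have h4 := hone _ h1
      rw [hg, mul_pow, h3]
      rw [mul_comm r k, pow_mul] at h4
      linear_combination (c ^ r * y ^ (r * s')) * h4
  · obtain ⟨s', rfl⟩ : ∃ s' : ℕ, s = s' := ⟨s.natAbs, by omega⟩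
    have hs' : (s' : ℝ) ≤ t ^ 57 := by
      have := hs; push_cast at this; rwa [abs_of_nonneg (Nat.cast_nonneg s')] at this
    have hone : ∀ x : ZMod p, x ≠ 0 → x ^ (r * k) = x ^ s' := by
      intro x hx
      refine ZMod.pow_eq_pow_of_sub_dvd hx ?_
      push_cast
      exact hdvd
    have hrs : r ≠ s' := by
      rintro rfl
      refine hord r hr0 hr ?_
      zify [hp1.le, hk1]
      convert hdvd using 1
      ring
    refine card_le_of_pos_exponent ht hp hr hs' hr0 (by omega) hrs hz0 (v := φ (z ^ k))
      ((map_ne_zero φ).2 (pow_ne_zero k z.ne_zero)) (φ (c⁻¹ ^ r)) _ ?_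
    intro y' hy'
    obtain ⟨y, hy, rfl⟩ := Finset.mem_image.1 hy'
    obtain ⟨h1, h2, h3⟩ := hmem y hy
    have hc : c ≠ 0 := by
      rintro rfl
      rw [zero_mul] at h3
      exact h2 h3
    have hg : 1 - (z : ZMod p) ^ k * y ^ s' = (1 - (z * y ^ r : ZMod p) ^ k) := by
      rw [mul_pow, ← pow_mul, hone y y.ne_zero]
    refine ⟨(hfacts y).1, (hfacts y).2, ?_, ?_, ?_⟩
    · rw [← map_pow, ← map_mul, ← map_one φ, ← map_sub]; exact (map_ne_zero φ).2 h1
    · rw [← map_pow, ← map_mul, ← map_one φ, ← map_sub, hg]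
      exact (map_ne_zero φ).2 h2
    · rw [← map_pow, ← map_mul, ← map_one φ, ← map_sub, ← map_pow, ← map_pow, ← map_mul, ← map_sub,
        ← map_pow, ← map_mul]
      congr 1
      rw [hg, h3, mul_pow, ← pow_mul, mul_comm k r, hone _ h1, ← mul_assoc, ← mul_pow,
        inv_mul_cancel₀ hc, one_pow, one_mul]

end FermatTypeCount

section BinomialSums

open Finset

variable {p : ℕ} [Fact p.Prime]

theorem ZMod.sum_norm_sq_sum_mul_stdAddChar {ι : Type*} [Fintype ι] (g : ι → ZMod p)
    (hg : Function.Injective g) (a : ι → ℂ) :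
    ∑ κ : ZMod p, ‖∑ x, a x * stdAddChar (κ * g x)‖ ^ 2 = p * ∑ x, ‖a x‖ ^ 2 := by
  classical
  have h : ∀ κ : ZMod p, ((‖∑ x, a x * stdAddChar (κ * g x)‖ ^ 2 : ℝ) : ℂ) =
      ∑ x, ∑ y, a x * (starRingEnd ℂ) (a y) * stdAddChar (κ * (g x - g y)) := by
    intro κ
    push_cast
    rw [← Complex.mul_conj', map_sum, sum_mul_sum]
    refine sum_congr rfl fun x _ => sum_congr rfl fun y _ => ?_
    rw [map_mul (starRingEnd ℂ), ← AddChar.map_neg_eq_conj, mul_sub, sub_eq_add_neg,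
      AddChar.map_add_eq_mul]
    ring
  apply Complex.ofReal_injective
  rw [Complex.ofReal_sum, sum_congr rfl fun κ _ => h κ, sum_comm]
  have h2 : ∀ x, ∑ κ : ZMod p, ∑ y, a x * (starRingEnd ℂ) (a y) * stdAddChar (κ * (g x - g y)) =
      p * ((‖a x‖ ^ 2 : ℝ) : ℂ) := by
    intro x
    rw [sum_comm, sum_eq_single x]
    · rw [← mul_sum, AddChar.sum_mulShift _ (ZMod.isPrimitive_stdAddChar p), sub_self, if_pos rfl,
        ZMod.card, Complex.mul_conj']
      push_cast; ring
    · intro y _ hy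
      rw [← mul_sum, AddChar.sum_mulShift _ (ZMod.isPrimitive_stdAddChar p),
        if_neg (sub_ne_zero.2 fun h => hy (hg h).symm)]
      simp
    · simp
  rw [sum_congr rfl fun x _ => h2 x, ← mul_sum]
  push_cast
  rfl

/-- The binomial exponential sum `∑ ψ (a x + b x ^ k)` over the nonzero residues. -/
noncomputable def binomialSum (p : ℕ) [Fact p.Prime] (k : ℕ) (a b : ZMod p) : ℂ :=
  ∑ x : (ZMod p)ˣ, ZMod.stdAddChar (a * (x : ZMod p) + b * (x : ZMod p) ^ k)

theorem binomialSum_scale (k : ℕ) (a b : ZMod p) (w : (ZMod p)ˣ) :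
    binomialSum p k (a * w) (b * (w : ZMod p) ^ k) = binomialSum p k a b := by
  unfold binomialSum
  rw [← Equiv.sum_comp (Equiv.mulLeft w)
    (fun x : (ZMod p)ˣ => (ZMod.stdAddChar (a * (x : ZMod p) + b * (x : ZMod p) ^ k) : ℂ))]
  refine sum_congr rfl fun x _ => ?_
  simp only [Equiv.coe_mulLeft, Units.val_mul, mul_pow]
  ring_nf

theorem binomialSum_eq (k : ℕ) {a : ZMod p} (ha : a ≠ 0) (b : ZMod p) :
    binomialSum p k a b = binomialSum p k 1 (b / a ^ k) := by
  have := binomialSum_scale k 1 (b / a ^ k) (Units.mk0 a ha)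
  rw [← this]
  simp [div_mul_cancel₀ b (pow_ne_zero k ha)]

theorem ZMod.units_pow_injective {k : ℕ} (hk : Nat.gcd k (p - 1) = 1) :
    Function.Injective fun x : (ZMod p)ˣ => x ^ k := by
  refine (Nat.Coprime.pow_left_bijective ?_).1
  rw [Nat.card_eq_fintype_card, ZMod.card_units]
  exact Nat.Coprime.symm hk

theorem sum_norm_sq_binomialSum {k : ℕ} (hk : Nat.gcd k (p - 1) = 1) :
    ∑ κ : ZMod p, ‖binomialSum p k 1 κ‖ ^ 2 = p * (p - 1) := by
  have hinj : Function.Injective fun x : (ZMod p)ˣ => (x : ZMod p) ^ k := by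
    intro x y h
    exact ZMod.units_pow_injective hk (Units.ext (by simpa using h))
  have h := ZMod.sum_norm_sq_sum_mul_stdAddChar _ hinj fun x => (ZMod.stdAddChar (x : ZMod p) : ℂ)
  have hp := (Fact.out : p.Prime).one_lt.le
  simp only [AddChar.norm_apply, one_pow, sum_const, card_univ, ZMod.card_units, nsmul_eq_mul,
    mul_one, Nat.cast_sub hp, Nat.cast_one] at h
  rw [← h]
  refine sum_congr rfl fun κ _ => ?_
  unfold binomialSum
  simp only [one_mul, AddChar.map_add_eq_mul]

theorem norm_sq_binomialSum_le {k : ℕ} (κ : ZMod p) :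
    ‖binomialSum p k 1 κ‖ ^ 2 ≤ p + ∑ u ∈ univ.erase (1 : (ZMod p)ˣ),
      ‖binomialSum p k 1 (κ * ((1 - (u : ZMod p) ^ k) / (1 - u) ^ k))‖ := by
  have h1 : ((‖binomialSum p k 1 κ‖ ^ 2 : ℝ) : ℂ) =
      ∑ u : (ZMod p)ˣ, binomialSum p k (1 - u) (κ * (1 - (u : ZMod p) ^ k)) := by
    push_cast
    rw [← Complex.mul_conj']
    unfold binomialSum
    rw [map_sum, sum_mul_sum, sum_comm]
    have h2 : ∀ y x : (ZMod p)ˣ, (ZMod.stdAddChar (1 * (x : ZMod p) + κ * (x : ZMod p) ^ k) : ℂ) *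
        (starRingEnd ℂ) (ZMod.stdAddChar (1 * (y : ZMod p) + κ * (y : ZMod p) ^ k)) =
        ZMod.stdAddChar ((x - y : ZMod p) + κ * ((x : ZMod p) ^ k - (y : ZMod p) ^ k)) := by
      intro y x
      rw [← AddChar.map_neg_eq_conj, ← AddChar.map_add_eq_mul]
      ring_nf
    simp only [h2]
    rw [sum_comm]
    conv_rhs => rw [sum_comm]
    refine sum_congr rfl fun x _ => ?_
    rw [← Equiv.sum_comp (Equiv.mulRight x)]
    refine sum_congr rfl fun u _ => ?_
    simp only [Equiv.coe_mulRight, Units.val_mul, mul_pow]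
    ring_nf
  have h3 : ‖binomialSum p k 1 κ‖ ^ 2 =
      ‖∑ u : (ZMod p)ˣ, binomialSum p k (1 - u) (κ * (1 - (u : ZMod p) ^ k))‖ := by
    rw [← h1, Complex.norm_real, Real.norm_of_nonneg (by positivity)]
  rw [h3]
  refine (norm_sum_le _ _).trans ?_
  rw [← add_sum_erase univ _ (mem_univ (1 : (ZMod p)ˣ))]
  gcongr with u hu
  · unfold binomialSum
    refine (norm_sum_le _ _).trans ?_
    simp only [AddChar.norm_apply, sum_const, card_univ, ZMod.card_units, nsmul_eq_mul, mul_one]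
    exact_mod_cast Nat.sub_le p 1
  · rw [binomialSum_eq, mul_div_assoc]
    rw [sub_ne_zero]
    intro h
    exact (mem_erase.1 hu).1 (Units.ext h.symm)

open Classical in
/-- A bound for binomial sums in terms of the number of solutions of
`1 - u ^ k = c (1 - u) ^ k`. -/
theorem norm_sq_binomialSum_le_of_card_le {k : ℕ} (hk : Nat.gcd k (p - 1) = 1) {N : ℝ}
    (hN : ∀ c : ZMod p, ((univ.filter fun u : (ZMod p)ˣ =>
      (1 - u : ZMod p) ≠ 0 ∧ (1 - (u : ZMod p) ^ k) ≠ 0 ∧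
        (1 - (u : ZMod p) ^ k) = c * (1 - u) ^ k).card : ℝ) ≤ N) {a b : ZMod p} (ha : a ≠ 0)
    (hb : b ≠ 0) :
    ‖binomialSum p k a b‖ ^ 2 ≤ p + Real.sqrt (p * (N * (p * p))) := by
  rw [binomialSum_eq k ha]
  set κ := b / a ^ k with hκ
  have hκ0 : κ ≠ 0 := div_ne_zero hb (pow_ne_zero k ha)
  refine (norm_sq_binomialSum_le κ).trans ?_
  gcongr
  set c : (ZMod p)ˣ → ZMod p := fun u => (1 - (u : ZMod p) ^ k) / (1 - u) ^ k with hc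
  set T := univ.erase (1 : (ZMod p)ˣ) with hT
  have hN0 : 0 ≤ N := (Nat.cast_nonneg _).trans (hN 0)
  have hp := (Fact.out : p.Prime).one_lt.le
  have hfib : ∀ x : ZMod p, ((T.filter fun u => c u = x).card : ℝ) ≤ N := by
    intro x
    refine le_trans ?_ (hN x)
    gcongr
    intro u hu
    obtain ⟨hu1, hu2⟩ := mem_filter.1 hu
    have hu1 : u ≠ 1 := (mem_erase.1 hu1).1
    have h1 : (1 - u : ZMod p) ≠ 0 := by
      rw [sub_ne_zero]; exact fun h => hu1 (Units.ext h.symm)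
    refine mem_filter.2 ⟨mem_univ u, h1, ?_, ?_⟩
    · rw [sub_ne_zero]
      intro h
      refine hu1 (ZMod.units_pow_injective hk (Units.ext ?_))
      simpa using h.symm
    · rw [← hu2, hc]
      simp only
      rw [div_mul_cancel₀ _ (pow_ne_zero k h1)]
  have hsum : ∑ u ∈ T, ‖binomialSum p k 1 (κ * c u)‖ ^ 2 ≤ N * (p * p) := by
    rw [← sum_fiberwise T c]
    calc ∑ x : ZMod p, ∑ u ∈ T with c u = x, ‖binomialSum p k 1 (κ * c u)‖ ^ 2
        = ∑ x : ZMod p, ((T.filter fun u => c u = x).card : ℝ) *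
            ‖binomialSum p k 1 (κ * x)‖ ^ 2 := by
          refine sum_congr rfl fun x _ => ?_
          rw [← nsmul_eq_mul, ← sum_const]
          refine sum_congr rfl fun u hu => ?_
          rw [(mem_filter.1 hu).2]
      _ ≤ ∑ x : ZMod p, N * ‖binomialSum p k 1 (κ * x)‖ ^ 2 := by
          gcongr with x _
          exact hfib x
      _ = N * ∑ x : ZMod p, ‖binomialSum p k 1 x‖ ^ 2 := by
          rw [← mul_sum]
          congr 1
          exact Equiv.sum_comp (Equiv.mulLeft₀ κ hκ0) fun x => ‖binomialSum p k 1 x‖ ^ 2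
      _ ≤ N * (p * p) := by
          rw [sum_norm_sq_binomialSum hk]
          gcongr
          linarith
  apply Real.le_sqrt_of_sq_le
  refine (sq_sum_le_card_mul_sum_sq).trans ?_
  gcongr
  exact_mod_cast (card_le_univ T).trans (by rw [ZMod.card_units]; exact Nat.sub_le p 1)

end BinomialSums

section DegenerateBinomialSums

open Finset

variable {p : ℕ} [Fact p.Prime]

theorem norm_sum_subgroup_stdAddChar_le (H : Subgroup (ZMod p)ˣ) [Fintype H] {y : ZMod p}
    (hy : y ≠ 0) :
    ‖∑ τ : H, (ZMod.stdAddChar (y * ((τ : (ZMod p)ˣ) : ZMod p)) : ℂ)‖ ≤ Real.sqrt p := by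
  apply Real.le_sqrt_of_sq_le
  set F : ZMod p → ℝ :=
    fun κ => ‖∑ τ : H, (ZMod.stdAddChar (κ * ((τ : (ZMod p)ˣ) : ZMod p)) : ℂ)‖ ^ 2 with hF
  have hval : Function.Injective fun τ : H => ((τ : (ZMod p)ˣ) : ZMod p) :=
    Units.val_injective.comp Subtype.val_injective
  have h1 := ZMod.sum_norm_sq_sum_mul_stdAddChar _ hval fun _ => 1
  simp only [one_mul, norm_one, one_pow, sum_const, card_univ, nsmul_eq_mul, mul_one] at h1
  have h2 : ∀ σ : H, F (y * ((σ : (ZMod p)ˣ) : ZMod p)) = F y := by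
    intro σ
    simp only [hF]
    congr 2
    rw [← Equiv.sum_comp (Equiv.mulLeft σ)
      fun τ : H => (ZMod.stdAddChar (y * ((τ : (ZMod p)ˣ) : ZMod p)) : ℂ)]
    refine sum_congr rfl fun τ _ => ?_
    simp [mul_assoc]
  have hinj : Function.Injective fun σ : H => y * ((σ : (ZMod p)ˣ) : ZMod p) :=
    (mul_right_injective₀ hy).comp hval
  have h3 : ∑ σ : H, F (y * ((σ : (ZMod p)ˣ) : ZMod p)) ≤ ∑ κ, F κ := by
    refine (sum_map univ ⟨_, hinj⟩ F).symm.le.trans ?_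
    exact sum_le_univ_sum_of_nonneg fun κ => by positivity
  rw [h1, sum_congr rfl fun σ _ => h2 σ, sum_const, card_univ, nsmul_eq_mul, mul_comm] at h3
  exact le_of_mul_le_mul_right h3 (by exact_mod_cast Fintype.card_pos)

theorem ZMod.card_units_pow_ker (m : ℕ) :
    Nat.card (powMonoidHom m : (ZMod p)ˣ →* (ZMod p)ˣ).ker = Nat.gcd m (p - 1) := by
  rw [IsCyclic.card_powMonoidHom_ker, Nat.card_eq_fintype_card, ZMod.card_units, Nat.gcd_comm]

theorem ZMod.card_units_pow_range (m : ℕ) :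
    Nat.card (powMonoidHom m : (ZMod p)ˣ →* (ZMod p)ˣ).range = (p - 1) / Nat.gcd m (p - 1) := by
  rw [IsCyclic.card_powMonoidHom_range, Nat.card_eq_fintype_card, ZMod.card_units, Nat.gcd_comm]

open Classical in
theorem card_filter_add_mul_pow_eq_zero_le (m : ℕ) (a : ZMod p) {b : ZMod p} (hb : b ≠ 0) :
    (univ.filter fun x : (ZMod p)ˣ => a + b * (x : ZMod p) ^ m = 0).card ≤ Nat.gcd m (p - 1) := by
  rw [← ZMod.card_units_pow_ker, Nat.card_eq_fintype_card]
  set Z := univ.filter fun x : (ZMod p)ˣ => a + b * (x : ZMod p) ^ m = 0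
  rcases Z.eq_empty_or_nonempty with h | ⟨x₀, hx₀⟩
  · rw [h]; simp
  have hker : ∀ x ∈ Z, x * x₀⁻¹ ∈ (powMonoidHom m : (ZMod p)ˣ →* (ZMod p)ˣ).ker := by
    intro x hx
    have h1 := (mem_filter.1 hx).2
    have h2 := (mem_filter.1 hx₀).2
    rw [MonoidHom.mem_ker, powMonoidHom_apply, mul_pow, inv_pow, mul_inv_eq_one]
    apply Units.ext
    push_cast
    apply mul_left_cancel₀ hb
    linear_combination h1 - h2
  rw [← Fintype.card_coe]
  refine Fintype.card_le_of_injective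
    (fun x : Z => (⟨x.1 * x₀⁻¹, hker x.1 x.2⟩ : (powMonoidHom m : (ZMod p)ˣ →* (ZMod p)ˣ).ker)) ?_
  intro x y hxy
  have := congrArg Subtype.val hxy
  exact Subtype.ext (mul_right_cancel this)

open Classical in
theorem norm_binomialSum_le_card_add {k : ℕ} (hk1 : 1 ≤ k) (a b : ZMod p) :
    ‖binomialSum p k a b‖ ≤
      (univ.filter fun x : (ZMod p)ˣ => a + b * (x : ZMod p) ^ (k - 1) = 0).card +
        ((p - 1) / Nat.gcd (k - 1) (p - 1) : ℕ) * Real.sqrt p := by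
  set H := (powMonoidHom (k - 1) : (ZMod p)ˣ →* (ZMod p)ˣ).ker with hH
  set d := Nat.gcd (k - 1) (p - 1) with hd
  have hcard : Fintype.card H = d := by rw [← Nat.card_eq_fintype_card, ZMod.card_units_pow_ker]
  have hp1 := (Fact.out : p.Prime).one_lt
  have hd0 : 0 < d := Nat.gcd_pos_of_pos_right _ (by omega)
  set Z := univ.filter fun x : (ZMod p)ˣ => a + b * (x : ZMod p) ^ (k - 1) = 0 with hZ
  set η : ZMod p → ℂ :=
    fun y => ∑ τ : H, (ZMod.stdAddChar (y * ((τ : (ZMod p)ˣ) : ZMod p)) : ℂ) with hη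
  have hpow : ∀ x : ZMod p, x ^ k = x * x ^ (k - 1) := fun x => by
    rw [← pow_succ', Nat.sub_add_cancel hk1]
  have h1 : (d : ℂ) * binomialSum p k a b =
      ∑ x : (ZMod p)ˣ, η (a * (x : ZMod p) + b * (x : ZMod p) ^ k) := by
    simp only [hη]
    rw [sum_comm, ← hcard, ← nsmul_eq_mul, ← card_univ, ← sum_const]
    refine sum_congr rfl fun τ _ => ?_
    rw [← binomialSum_scale k a b τ, binomialSum]
    refine sum_congr rfl fun x _ => ?_
    have h2 : (((τ : (ZMod p)ˣ) : ZMod p)) ^ (k - 1) = 1 := by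
      have : (τ : (ZMod p)ˣ) ^ (k - 1) = 1 := τ.2
      rw [← Units.val_pow_eq_pow_val, this, Units.val_one]
    rw [hpow (((τ : (ZMod p)ˣ) : ZMod p)), h2]
    ring_nf
  have h2 : (d : ℝ) * ‖binomialSum p k a b‖ ≤ Z.card * d + (p - 1 : ℕ) * Real.sqrt p := by
    have h3 := congrArg norm h1
    rw [norm_mul, Complex.norm_natCast] at h3
    rw [h3]
    refine (norm_sum_le _ _).trans ?_
    rw [← sum_filter_add_sum_filter_not univ
      (fun x : (ZMod p)ˣ => a + b * (x : ZMod p) ^ (k - 1) = 0), ← hZ]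
    refine add_le_add ?_ ?_
    · rw [← nsmul_eq_mul]
      refine sum_le_card_nsmul _ _ _ fun x _ => ?_
      refine (norm_sum_le _ _).trans ?_
      simp [AddChar.norm_apply, ← hcard]
    · refine (sum_le_card_nsmul _ _ (Real.sqrt p) fun x hx => ?_).trans ?_
      · refine norm_sum_subgroup_stdAddChar_le H ?_
        rw [hpow]
        have := (mem_filter.1 hx).2
        rw [show a * (x : ZMod p) + b * (x * x ^ (k - 1)) = x * (a + b * x ^ (k - 1)) by ring]
        exact mul_ne_zero x.ne_zero this
      · rw [nsmul_eq_mul]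
        gcongr
        exact (card_le_univ _).trans (by rw [ZMod.card_units])
  have h3 : ((p - 1 : ℕ) : ℝ) = d * ((p - 1) / d : ℕ) := by
    rw [← Nat.cast_mul, Nat.mul_div_cancel' (Nat.gcd_dvd_right _ _)]
  rw [h3] at h2
  have hd0' : (0 : ℝ) < d := by exact_mod_cast hd0
  nlinarith

end DegenerateBinomialSums

section FourierCounting

open Finset

theorem Finset.sum_inv_le_harmonic (T : Finset ℕ) (hT : ∀ m ∈ T, 0 < m) :
    ∑ m ∈ T, (m : ℝ)⁻¹ ≤ harmonic T.card := by
  induction T using Finset.induction_on_max with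
  | empty => simp
  | insert a s hmax ih =>
    have ha : a ∉ s := fun h => lt_irrefl a (hmax a h)
    have hcard : s.card + 1 ≤ a := by
      have hsub : s ⊆ Finset.Ico 1 a := fun x hx =>
        Finset.mem_Ico.2 ⟨hT x (mem_insert_of_mem hx), hmax x hx⟩
      have h1 := card_le_card hsub
      have h2 := hT a (mem_insert_self a s)
      rw [Nat.card_Ico] at h1
      omega
    rw [sum_insert ha, card_insert_of_notMem ha, harmonic_succ, add_comm]
    push_cast
    gcongr
    · exact_mod_cast ih fun m hm => hT m (mem_insert_of_mem hm)
    · exact_mod_cast hcard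

theorem Finset.sum_inv_le_one_add_log (T : Finset ℕ) (hT : ∀ m ∈ T, 0 < m) {N : ℕ}
    (hN : T.card ≤ N) : ∑ m ∈ T, (m : ℝ)⁻¹ ≤ 1 + Real.log N := by
  refine (Finset.sum_inv_le_harmonic T hT).trans ?_
  refine (harmonic_le_one_add_log _).trans ?_
  rcases Nat.eq_zero_or_pos T.card with h0 | h0
  · rw [h0, Nat.cast_zero, Real.log_zero]
    linarith [Real.log_natCast_nonneg N]
  · gcongr

variable {p : ℕ} [Fact p.Prime]

theorem ZMod.sum_inv_natAbs_valMinAbs_le (R : Finset (ZMod p)) (hR : ∀ y ∈ R, y ≠ 0) :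
    ∑ y ∈ R, ((y.valMinAbs.natAbs : ℝ))⁻¹ ≤ 2 * (1 + Real.log R.card) := by
  have h0 : ∀ y ∈ R, 0 < y.valMinAbs.natAbs := fun y hy => by
    rw [Int.natAbs_pos, Ne, ZMod.valMinAbs_eq_zero]; exact hR y hy
  have key : ∀ R' ⊆ R, Set.InjOn (fun y : ZMod p => y.valMinAbs.natAbs) R' →
      ∑ y ∈ R', ((y.valMinAbs.natAbs : ℝ))⁻¹ ≤ 1 + Real.log R.card := by
    intro R' hR' hinj
    rw [← sum_image (f := fun m : ℕ => (m : ℝ)⁻¹) hinj]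
    refine Finset.sum_inv_le_one_add_log _ ?_ (card_image_le.trans (card_le_card hR'))
    intro m hm
    obtain ⟨y, hy, rfl⟩ := mem_image.1 hm
    exact h0 y (hR' hy)
  rw [← sum_filter_add_sum_filter_not R fun y => 0 ≤ y.valMinAbs, two_mul]
  refine add_le_add (key _ (filter_subset _ _) ?_) (key _ (filter_subset _ _) ?_)
  · intro x hx y hy h
    have h1 := (mem_filter.1 hx).2
    have h2 := (mem_filter.1 hy).2
    apply ZMod.injective_valMinAbs
    simp only at h
    omega
  · intro x hx y hy h
    have h1 := (mem_filter.1 hx).2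
    have h2 := (mem_filter.1 hy).2
    apply ZMod.injective_valMinAbs
    simp only at h
    omega

theorem inv_sin_le {x : ℝ} (h0 : 0 < x) (h1 : x ≤ 1 / 2) :
    (Real.sin (Real.pi * x))⁻¹ ≤ 0.332 / x + 4 := by
  have hpi := Real.pi_gt_d4
  have hpi' := Real.pi_lt_d4
  rcases le_or_gt x (1 / 8) with hx | hx
  · have h2 := Real.sin_gt_sub_cube (x := Real.pi * x) (by positivity)
    have h3 : x / 0.332 ≤ Real.sin (Real.pi * x) := by
      refine le_trans ?_ h2.le
      have h4 : (Real.pi * x) ^ 2 ≤ 0.16 := by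
        have h6 : Real.pi * x ≤ 0.4 := by nlinarith
        have h7 : 0 ≤ Real.pi * x := by positivity
        nlinarith
      have h5 : (Real.pi * x) ^ 3 ≤ 0.16 * (Real.pi * x) := by
        rw [pow_succ]; gcongr
      have h6 : 3.1415 * x ≤ Real.pi * x := by gcongr
      rw [div_le_iff₀ (by norm_num)]
      linarith
    calc (Real.sin (Real.pi * x))⁻¹ ≤ (x / 0.332)⁻¹ := by gcongr
      _ = 0.332 / x := inv_div _ _
      _ ≤ _ := by linarith
  · have h2 := Real.mul_le_sin (x := Real.pi * x) (by positivity) (by nlinarith)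
    have h3 : (1 / 4 : ℝ) ≤ Real.sin (Real.pi * x) := by
      refine le_trans ?_ h2
      rw [← mul_assoc, div_mul_cancel₀ _ Real.pi_pos.ne']
      linarith
    calc (Real.sin (Real.pi * x))⁻¹ ≤ (1 / 4 : ℝ)⁻¹ := by gcongr
      _ = 4 := by norm_num
      _ ≤ _ := by have : 0 < 0.332 / x := by positivity
                  linarith

theorem two_div_norm_stdAddChar_sub_one_le {y : ZMod p} (hy : y ≠ 0) :
    0 < ‖(ZMod.stdAddChar y : ℂ) - 1‖ ∧ 2 / ‖(ZMod.stdAddChar y : ℂ) - 1‖ ≤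
      0.332 * p * (y.valMinAbs.natAbs : ℝ)⁻¹ + 4 := by
  have hp : (0 : ℝ) < p := by exact_mod_cast (Fact.out : p.Prime).pos
  have hv : 0 < y.valMinAbs.natAbs := by
    rw [Int.natAbs_pos, Ne, ZMod.valMinAbs_eq_zero]; exact hy
  have hv' : (0 : ℝ) < (y.valMinAbs.natAbs : ℝ) := by exact_mod_cast hv
  set x : ℝ := y.valMinAbs.natAbs / p with hx
  have hx0 : 0 < x := div_pos hv' hp
  have hx1 : x ≤ 1 / 2 := by
    rw [hx, div_le_iff₀ hp]
    have := ZMod.natAbs_valMinAbs_le y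
    have h2 : ((y.valMinAbs.natAbs : ℕ) : ℝ) ≤ ((p / 2 : ℕ) : ℝ) := by exact_mod_cast this
    have h3 : ((p / 2 : ℕ) : ℝ) ≤ p / 2 := Nat.cast_div_le
    linarith
  have hnorm : ‖(ZMod.stdAddChar y : ℂ) - 1‖ = 2 * Real.sin (Real.pi * x) := by
    have h1 : (ZMod.stdAddChar y : ℂ) =
        Complex.exp (Complex.I * ((2 * Real.pi * y.valMinAbs / p : ℝ) : ℂ)) := by
      conv_lhs => rw [← ZMod.coe_valMinAbs y, ZMod.stdAddChar_coe]
      congr 1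
      push_cast
      ring
    rw [h1, Complex.norm_exp_I_mul_ofReal_sub_one, norm_mul, Real.norm_ofNat, Real.norm_eq_abs]
    congr 1
    have hs : 0 < Real.sin (Real.pi * x) :=
      Real.sin_pos_of_pos_of_lt_pi (by positivity) (by nlinarith [Real.pi_pos])
    rw [← abs_of_pos hs]
    have hnat : ((y.valMinAbs.natAbs : ℕ) : ℝ) = |(y.valMinAbs : ℝ)| := by
      rw [← Int.cast_natCast, Int.natCast_natAbs, Int.cast_abs]
    rcases abs_cases (y.valMinAbs : ℝ) with ⟨h, -⟩ | ⟨h, -⟩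
    · congr 2
      rw [hx, hnat, h]; ring
    · rw [← abs_neg, ← Real.sin_neg]
      congr 2
      rw [hx, hnat, h]; ring
  have hs : 0 < Real.sin (Real.pi * x) :=
    Real.sin_pos_of_pos_of_lt_pi (by positivity) (by nlinarith [Real.pi_pos])
  rw [hnorm]
  refine ⟨by positivity, ?_⟩
  have h4 := inv_sin_le hx0 hx1
  calc 2 / (2 * Real.sin (Real.pi * x)) = (Real.sin (Real.pi * x))⁻¹ := by field_simp
    _ ≤ 0.332 / x + 4 := h4
    _ = _ := by rw [hx]; field_simp

/-- If the Fourier coefficients of a weight are controlled by a geometric sum, then they are small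
on average. -/
theorem sum_le_of_mul_norm_sub_one_le {w : ZMod p → ℝ} {n : ZMod p} (hn : n ≠ 0)
    (hw : ∀ a, w a * ‖(ZMod.stdAddChar (a * n) : ℂ) - 1‖ ≤ 2) (R : Finset (ZMod p))
    (hR : ∀ a ∈ R, a ≠ 0) : ∑ a ∈ R, w a ≤ p * (0.664 * Real.log R.card + 5) := by
  have hp : (0 : ℝ) < p := by exact_mod_cast (Fact.out : p.Prime).pos
  have h1 : ∀ a ∈ R, w a ≤ 0.332 * p * ((a * n).valMinAbs.natAbs : ℝ)⁻¹ + 4 := by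
    intro a ha
    obtain ⟨h2, h3⟩ := two_div_norm_stdAddChar_sub_one_le (mul_ne_zero (hR a ha) hn)
    exact ((le_div_iff₀ h2).2 (hw a)).trans h3
  refine (sum_le_sum h1).trans ?_
  have hinj : Function.Injective fun a : ZMod p => a * n := mul_left_injective₀ hn
  have h2 := ZMod.sum_inv_natAbs_valMinAbs_le (R.image fun a => a * n) (by
    intro y hy
    obtain ⟨a, ha, rfl⟩ := mem_image.1 hy
    exact mul_ne_zero (hR a ha) hn)
  rw [sum_image hinj.injOn, card_image_of_injective R hinj] at h2
  have hcard : (R.card : ℝ) ≤ p := by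
    have := card_le_univ R
    rw [ZMod.card] at this
    exact_mod_cast this
  have hp2 : (2 : ℝ) ≤ p := by exact_mod_cast (Fact.out : p.Prime).two_le
  rw [sum_add_distrib, ← mul_sum, sum_const, nsmul_eq_mul]
  nlinarith

open Classical in
/-- The Fourier expansion of the number of points of the graph of a permutation in a box. -/
theorem abs_card_sub_le_sum_fourier (I J : Finset (ZMod p)) {φ : ZMod p → ZMod p}
    (hφ : Function.Bijective φ) :
    |(p : ℝ) ^ 2 * (I.filter fun x => φ x ∈ J).card - p * (I.card * J.card)| ≤
      ∑ a ∈ univ.erase (0 : ZMod p), ∑ b ∈ univ.erase (0 : ZMod p),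
        ‖∑ m ∈ I, (ZMod.stdAddChar (-(a * m)) : ℂ)‖ * ‖∑ l ∈ J, (ZMod.stdAddChar (-(b * l)) : ℂ)‖ *
          ‖∑ x, (ZMod.stdAddChar (a * x + b * φ x) : ℂ)‖ := by
  set ψ : AddChar (ZMod p) ℂ := ZMod.stdAddChar with hψ
  have hprim : ψ.IsPrimitive := ZMod.isPrimitive_stdAddChar p
  set G : ZMod p → ZMod p → ℂ := fun a b => (∑ m ∈ I, ψ (-(a * m))) * (∑ l ∈ J, ψ (-(b * l))) *
    ∑ x, ψ (a * x + b * φ x) with hG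
  have hind : ∀ (S : Finset (ZMod p)) (x : ZMod p),
      ∑ a : ZMod p, (∑ m ∈ S, ψ (-(a * m))) * ψ (a * x) = if x ∈ S then (p : ℂ) else 0 := by
    intro S x
    have h1 : ∀ a : ZMod p, (∑ m ∈ S, ψ (-(a * m))) * ψ (a * x) = ∑ m ∈ S, ψ (a * (x - m)) := by
      intro a
      rw [sum_mul]
      refine sum_congr rfl fun m _ => ?_
      rw [← AddChar.map_add_eq_mul]; ring_nf
    rw [sum_congr rfl fun a _ => h1 a, sum_comm]
    simp only [AddChar.sum_mulShift _ hprim, ZMod.card]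
    simp only [sub_eq_zero, Nat.cast_ite, Nat.cast_zero]
    rw [sum_ite_eq]
  have htot : ∑ a, ∑ b, G a b = (p : ℂ) ^ 2 * (I.filter fun x => φ x ∈ J).card := by
    have h1 : ∑ a, ∑ b, G a b = ∑ x, (∑ a : ZMod p, (∑ m ∈ I, ψ (-(a * m))) * ψ (a * x)) *
        (∑ b : ZMod p, (∑ l ∈ J, ψ (-(b * l))) * ψ (b * φ x)) := by
      have h2 : ∀ x, (∑ a : ZMod p, (∑ m ∈ I, ψ (-(a * m))) * ψ (a * x)) *
          (∑ b : ZMod p, (∑ l ∈ J, ψ (-(b * l))) * ψ (b * φ x)) =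
          ∑ a : ZMod p, ∑ b : ZMod p, (∑ m ∈ I, ψ (-(a * m))) * (∑ l ∈ J, ψ (-(b * l))) *
            ψ (a * x + b * φ x) := by
        intro x
        rw [sum_mul_sum]
        refine sum_congr rfl fun a _ => sum_congr rfl fun b _ => ?_
        rw [AddChar.map_add_eq_mul]
        ring
      rw [sum_congr rfl fun x _ => h2 x]
      refine Eq.trans ?_ sum_comm
      refine sum_congr rfl fun a _ => ?_
      refine Eq.trans ?_ sum_comm
      refine sum_congr rfl fun b _ => ?_
      simp only [hG, mul_sum]
    rw [h1]
    simp only [hind]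
    rw [card_filter, Nat.cast_sum, mul_sum]
    rw [← sum_filter_add_sum_filter_not univ (fun x => x ∈ I)]
    rw [sum_eq_zero (s := univ.filter fun x => ¬ x ∈ I) (fun x hx => by
      rw [if_neg (mem_filter.1 hx).2, zero_mul]), add_zero]
    rw [filter_mem_eq_inter, univ_inter]
    refine sum_congr rfl fun x hx => ?_
    rw [if_pos hx]
    split_ifs <;> simp [pow_two]
  have hzero : ∀ b, b ≠ 0 → G 0 b = 0 := by
    intro b hb
    have : ∑ x, ψ (0 * x + b * φ x) = 0 := by
      simp only [zero_mul, zero_add]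
      rw [hφ.sum_comp fun x => ψ (b * x)]
      have := AddChar.sum_mulShift b hprim
      simp only [mul_comm _ b, if_neg hb, Nat.cast_zero] at this
      exact this
    simp only [hG, this, mul_zero]
  have hzero' : ∀ a, a ≠ 0 → G a 0 = 0 := by
    intro a ha
    have : ∑ x, ψ (a * x + 0 * φ x) = 0 := by
      simp only [zero_mul, add_zero]
      have := AddChar.sum_mulShift a hprim
      simp only [mul_comm _ a, if_neg ha, Nat.cast_zero] at this
      exact this
    simp only [hG, this, mul_zero]
  have h00 : G 0 0 = p * (I.card * J.card) := by
    simp [hG, ZMod.card]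
    ring
  have hsplit : ∑ a, ∑ b, G a b =
      G 0 0 + ∑ a ∈ univ.erase (0 : ZMod p), ∑ b ∈ univ.erase (0 : ZMod p), G a b := by
    rw [← add_sum_erase univ _ (mem_univ (0 : ZMod p))]
    congr 1
    · rw [← add_sum_erase univ _ (mem_univ (0 : ZMod p)),
        sum_eq_zero fun b hb => hzero b (mem_erase.1 hb).1, add_zero]
    · refine sum_congr rfl fun a ha => ?_
      rw [← add_sum_erase univ _ (mem_univ (0 : ZMod p)), hzero' a (mem_erase.1 ha).1, zero_add]
  have hfin : (((p : ℝ) ^ 2 * (I.filter fun x => φ x ∈ J).card - p * (I.card * J.card) : ℝ) : ℂ) =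
      ∑ a ∈ univ.erase (0 : ZMod p), ∑ b ∈ univ.erase (0 : ZMod p), G a b := by
    push_cast
    rw [← htot, hsplit, h00]
    ring
  rw [← Real.norm_eq_abs, ← Complex.norm_real, hfin]
  refine (norm_sum_le _ _).trans (sum_le_sum fun a _ => ?_)
  refine (norm_sum_le _ _).trans (sum_le_sum fun b _ => ?_)
  simp only [hG, norm_mul, le_refl]

end FourierCounting

section BoxBound

open Finset

theorem Iclass_eq_image {p n j : ℕ} (hj : j < n) (hjp : j < p) :
    Iclass p n j =
      (Ico (if j = 0 then 1 else 0) ((p - 1 - j) / n + 1)).image fun m => j + n * m := by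
  have hn : 0 < n := by omega
  ext x
  simp only [Iclass, mem_filter, mem_Icc, mem_image, mem_Ico]
  constructor
  · rintro ⟨⟨h1, h2⟩, h3⟩
    have h4 := Nat.mod_add_div x n
    refine ⟨x / n, ⟨?_, ?_⟩, by omega⟩
    · split_ifs with h
      · refine Nat.one_le_iff_ne_zero.2 fun h5 => ?_
        rw [h5] at h4
        omega
      · exact Nat.zero_le _
    · rw [Nat.lt_add_one_iff, Nat.le_div_iff_mul_le hn, mul_comm]
      omega
  · rintro ⟨m, ⟨h1, h2⟩, rfl⟩
    rw [Nat.lt_add_one_iff, Nat.le_div_iff_mul_le hn, mul_comm] at h2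
    refine ⟨⟨?_, by omega⟩, ?_⟩
    · split_ifs at h1 with h
      · have := Nat.mul_pos hn h1
        omega
      · omega
    · rw [Nat.add_mul_mod_self_left, Nat.mod_eq_of_lt hj]

variable {p : ℕ} [Fact p.Prime]

open Classical in
theorem abs_card_sub_le_of_norm_sum_le (I J : Finset (ZMod p)) {φ : ZMod p → ZMod p}
    (hφ : Function.Bijective φ) {n : ZMod p} (hn : n ≠ 0)
    (hI : ∀ a, ‖∑ m ∈ I, (ZMod.stdAddChar (-(a * m)) : ℂ)‖ *
      ‖(ZMod.stdAddChar (a * n) : ℂ) - 1‖ ≤ 2)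
    (hJ : ∀ a, ‖∑ m ∈ J, (ZMod.stdAddChar (-(a * m)) : ℂ)‖ *
      ‖(ZMod.stdAddChar (a * n) : ℂ) - 1‖ ≤ 2)
    {M D : ℝ} (hM : 0 ≤ M) (hD : 0 ≤ D) {H : ℕ} (R : ZMod p → Finset (ZMod p))
    (hR : ∀ b, ∀ a ∈ R b, a ≠ 0) (hRH : ∀ b, b ≠ 0 → (R b).card ≤ H)
    (hT : ∀ a b, a ≠ 0 → b ≠ 0 → ‖∑ x, (ZMod.stdAddChar (a * x + b * φ x) : ℂ)‖ ≤
      M + if a ∈ R b then D else 0) :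
    |((I.filter fun x => φ x ∈ J).card : ℝ) - I.card * J.card / p| ≤
      M * (0.664 * Real.log p + 5) ^ 2 +
        D * ((0.664 * Real.log H + 5) * (0.664 * Real.log p + 5)) := by
  have hp : (0 : ℝ) < p := by exact_mod_cast (Fact.out : p.Prime).pos
  have hlogp : 0 ≤ Real.log p := Real.log_natCast_nonneg p
  have hlogH : 0 ≤ Real.log H := Real.log_natCast_nonneg H
  set U := univ.erase (0 : ZMod p) with hU
  have hUne : ∀ a ∈ U, a ≠ 0 := fun a ha => (mem_erase.1 ha).1
  have hlogmono : ∀ {a b : ℕ}, a ≤ b → Real.log a ≤ Real.log b := by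
    intro a b hab
    rcases Nat.eq_zero_or_pos a with rfl | ha
    · simpa using Real.log_natCast_nonneg b
    · gcongr
  have hUlog : Real.log U.card ≤ Real.log p := by
    apply hlogmono
    have := card_le_univ U
    rwa [ZMod.card] at this
  set w := fun a => ‖∑ m ∈ I, (ZMod.stdAddChar (-(a * m)) : ℂ)‖ with hw
  set v := fun a => ‖∑ m ∈ J, (ZMod.stdAddChar (-(a * m)) : ℂ)‖ with hv
  have hw0 : ∀ a, 0 ≤ w a := fun a => norm_nonneg _
  have hv0 : ∀ a, 0 ≤ v a := fun a => norm_nonneg _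
  set L := 0.664 * Real.log p + 5 with hL
  set K := 0.664 * Real.log H + 5 with hK
  have hL0 : 0 ≤ L := by positivity
  have hK0 : 0 ≤ K := by positivity
  have hwU : ∑ a ∈ U, w a ≤ p * L := by
    refine (sum_le_of_mul_norm_sub_one_le hn hI U hUne).trans ?_
    rw [hL]; gcongr
  have hvU : ∑ a ∈ U, v a ≤ p * L := by
    refine (sum_le_of_mul_norm_sub_one_le hn hJ U hUne).trans ?_
    rw [hL]; gcongr
  have hwR : ∀ b, b ≠ 0 → ∑ a ∈ R b, w a ≤ p * K := by
    intro b hb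
    refine (sum_le_of_mul_norm_sub_one_le hn hI _ (hR b)).trans ?_
    have := hlogmono (hRH b hb)
    rw [hK]; gcongr
  have hRU : ∀ b, R b ⊆ U := fun b a ha => mem_erase.2 ⟨hR b a ha, mem_univ a⟩
  have key : ∑ a ∈ U, ∑ b ∈ U, w a * v b * ‖∑ x, (ZMod.stdAddChar (a * x + b * φ x) : ℂ)‖ ≤
      p ^ 2 * (M * L ^ 2 + D * (K * L)) := by
    rw [sum_comm]
    have hb : ∀ b ∈ U, ∑ a ∈ U, w a * v b * ‖∑ x, (ZMod.stdAddChar (a * x + b * φ x) : ℂ)‖ ≤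
        v b * (p * (M * L + D * K)) := by
      intro b hb
      have hb0 := hUne b hb
      calc ∑ a ∈ U, w a * v b * ‖∑ x, (ZMod.stdAddChar (a * x + b * φ x) : ℂ)‖
          ≤ ∑ a ∈ U, w a * v b * (M + if a ∈ R b then D else 0) := by
            refine sum_le_sum fun a ha => ?_
            exact mul_le_mul_of_nonneg_left (hT a b (hUne a ha) hb0)
              (mul_nonneg (hw0 a) (hv0 b))
        _ = v b * (M * ∑ a ∈ U, w a + D * ∑ a ∈ R b, w a) := by
            have h1 : ∑ a ∈ R b, w a = ∑ a ∈ U, if a ∈ R b then w a else 0 := by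
              rw [sum_ite_mem, inter_eq_right.2 (hRU b)]
            rw [h1, mul_sum, mul_sum, ← sum_add_distrib, mul_sum]
            refine sum_congr rfl fun a _ => ?_
            split_ifs <;> ring
        _ ≤ v b * (M * (p * L) + D * (p * K)) := by
            have := hwR b hb0
            have := hv0 b
            gcongr
        _ = _ := by ring
    refine (sum_le_sum hb).trans ?_
    rw [← sum_mul]
    calc (∑ b ∈ U, v b) * (p * (M * L + D * K)) ≤ (p * L) * (p * (M * L + D * K)) := by
          gcongr
      _ = _ := by ring
  have h := (abs_card_sub_le_sum_fourier I J hφ).trans key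
  have h2 : (p : ℝ) ^ 2 * (I.filter fun x => φ x ∈ J).card - p * (I.card * J.card) =
      p ^ 2 * (((I.filter fun x => φ x ∈ J).card : ℝ) - I.card * J.card / p) := by
    field_simp
  rw [h2, abs_mul, abs_of_pos (by positivity)] at h
  exact le_of_mul_le_mul_left h (by positivity)

theorem Iclass_cast_injOn (n j : ℕ) :
    Set.InjOn (fun x : ℕ => (x : ZMod p)) (Iclass p n j) := by
  intro x hx y hy h
  simp only [Iclass, coe_filter, mem_Icc, Set.mem_ofPred_eq] at hx hy
  have hp := (Fact.out : p.Prime).pos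
  exact Nat.ModEq.eq_of_lt_of_lt ((ZMod.natCast_eq_natCast_iff _ _ _).1 h) (by omega) (by omega)

theorem norm_sum_Iclass_mul_le {n j : ℕ} (hj : j < n) (hnp : n < p) (a : ZMod p) :
    ‖∑ m ∈ (Iclass p n j).image (fun x : ℕ => (x : ZMod p)), (ZMod.stdAddChar (-(a * m)) : ℂ)‖ *
      ‖(ZMod.stdAddChar (a * -(n : ZMod p)) : ℂ) - 1‖ ≤ 2 := by
  have hjp : j < p := by omega
  have hn : 0 < n := by omega
  rw [sum_image (Iclass_cast_injOn n j), Iclass_eq_image hj hjp, sum_image (by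
    intro x _ y _ h
    exact Nat.eq_of_mul_eq_mul_left hn (by simpa using h))]
  set z : ℂ := ZMod.stdAddChar (a * -(n : ZMod p)) with hz
  have hz1 : ‖z‖ = 1 := AddChar.norm_apply _ _
  have hterm : ∀ m : ℕ, (ZMod.stdAddChar (-(a * ((j + n * m : ℕ) : ZMod p))) : ℂ) =
      ZMod.stdAddChar (-(a * (j : ZMod p))) * z ^ m := by
    intro m
    rw [hz, ← AddChar.map_nsmul_eq_pow, ← AddChar.map_add_eq_mul]
    congr 1
    push_cast [nsmul_eq_mul]
    ring
  simp only [hterm]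
  rw [← mul_sum, norm_mul, AddChar.norm_apply, one_mul, ← norm_mul]
  have hle : (if j = 0 then 1 else 0) ≤ (p - 1 - j) / n + 1 := by
    generalize (p - 1 - j) / n = q
    split_ifs <;> omega
  rw [geom_sum_Ico_mul z hle]
  refine (norm_sub_le _ _).trans ?_
  rw [norm_pow, norm_pow, hz1, one_pow, one_pow]
  norm_num

theorem bijective_mul_pow {k : ℕ} (hk1 : 1 ≤ k) (hk : Nat.gcd k (p - 1) = 1) {A : ZMod p}
    (hA : A ≠ 0) : Function.Bijective fun x : ZMod p => A * x ^ k := by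
  rw [Fintype.bijective_iff_injective_and_card]
  refine ⟨?_, rfl⟩
  intro x y h
  have h1 : x ^ k = y ^ k := mul_left_cancel₀ hA h
  have hk0 : k ≠ 0 := by omega
  rcases eq_or_ne x 0 with rfl | hx
  · rw [zero_pow hk0] at h1
    exact (pow_eq_zero_iff hk0).1 h1.symm |>.symm
  · have hy : y ≠ 0 := by
      rintro rfl
      rw [zero_pow hk0] at h1
      exact hx ((pow_eq_zero_iff hk0).1 h1)
    have h2 := ZMod.units_pow_injective (p := p) hk (a₁ := Units.mk0 x hx) (a₂ := Units.mk0 y hy)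
      (Units.ext (by simpa using h1))
    simpa using congrArg Units.val h2

theorem sum_stdAddChar_eq_one_add_binomialSum {k : ℕ} (hk1 : 1 ≤ k) (a b : ZMod p) :
    ∑ x : ZMod p, (ZMod.stdAddChar (a * x + b * x ^ k) : ℂ) = 1 + binomialSum p k a b := by
  have hk0 : k ≠ 0 := by omega
  rw [Fintype.sum_eq_add_sum_compl (0 : ZMod p), mul_zero, zero_pow hk0, mul_zero, add_zero,
    AddChar.map_zero_eq_one, binomialSum]
  congr 1
  refine (sum_bij' (fun (x : (ZMod p)ˣ) _ => (x : ZMod p))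
    (fun x hx => Units.mk0 x (by simpa using hx)) ?_ ?_ ?_ ?_ ?_).symm
  all_goals simp

end BoxBound

section MainCase

open Finset

variable {p : ℕ} [Fact p.Prime]

theorem card_units_pow_image (m : ℕ) :
    (univ.image fun x : (ZMod p)ˣ => x ^ m).card = (p - 1) / Nat.gcd m (p - 1) := by
  rw [← ZMod.card_units_pow_range m, ← Set.ncard_coe_finset]
  simp only [coe_image, coe_univ, Set.image_univ]
  rfl

open Classical in
/-- The exponential sum is dominated by its value on a small exceptional set of frequencies. -/
theorem exists_norm_binomialSum_le {k : ℕ} (hk1 : 1 ≤ k) {b : ZMod p} (hb : b ≠ 0) :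
    ∃ R : Finset (ZMod p), (∀ a ∈ R, a ≠ 0) ∧ R.card ≤ (p - 1) / Nat.gcd (k - 1) (p - 1) ∧
      ∀ a, ‖binomialSum p k a b‖ ≤ ((p - 1) / Nat.gcd (k - 1) (p - 1) : ℕ) * √p +
        if a ∈ R then (Nat.gcd (k - 1) (p - 1) : ℝ) else 0 := by
  refine ⟨(univ.image fun x : (ZMod p)ˣ => x ^ (k - 1)).image
    fun y : (ZMod p)ˣ => -(b * (y : ZMod p)),
    ?_, card_image_le.trans (card_units_pow_image _).le, fun a => ?_⟩
  · intro a ha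
    obtain ⟨y, -, rfl⟩ := mem_image.1 ha
    exact neg_ne_zero.2 (mul_ne_zero hb y.ne_zero)
  · refine (norm_binomialSum_le_card_add hk1 a b).trans ?_
    rw [add_comm]
    gcongr
    split_ifs with h
    · exact_mod_cast card_filter_add_mul_pow_eq_zero_le (k - 1) a hb
    · rw [filter_eq_empty_iff.2, card_empty, Nat.cast_zero]
      intro x _ hx
      refine h (mem_image.2 ⟨x ^ (k - 1), mem_image_of_mem _ (mem_univ x), ?_⟩)
      rw [Units.val_pow_eq_pow_val]
      exact (eq_neg_of_add_eq_zero_left hx).symm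

theorem not_dvd_mul_of_lt_div_gcd {m N : ℕ} (hN : 0 < N) {r : ℕ} (hr : 0 < r)
    (h : r < N / Nat.gcd m N) : ¬ N ∣ r * m := by
  intro hdvd
  have hg : 0 < Nat.gcd m N := Nat.gcd_pos_of_pos_right m hN
  have hco : Nat.Coprime (N / Nat.gcd m N) (m / Nat.gcd m N) :=
    (Nat.coprime_div_gcd_div_gcd hg).symm
  have h1 : N / Nat.gcd m N ∣ r * (m / Nat.gcd m N) := by
    rw [← Nat.mul_div_assoc _ (Nat.gcd_dvd_left m N)]
    exact Nat.div_dvd_div (Nat.gcd_dvd_right m N) hdvd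
  exact absurd (Nat.le_of_dvd hr (hco.dvd_of_dvd_mul_right h1)) (not_le.2 h)

theorem exp_mul_rpow_le {x a b c : ℝ} (hx : Real.exp 340 < x) (hab : a ≤ b)
    (hc : c ≤ 340 * (b - a)) : Real.exp c * x ^ a ≤ x ^ b := by
  have hx0 : 0 < x := (Real.exp_pos _).trans hx
  have hl : 340 < Real.log x := (Real.lt_log_iff_exp_lt hx0).2 hx
  rw [Real.rpow_def_of_pos hx0, Real.rpow_def_of_pos hx0, ← Real.exp_add, Real.exp_le_exp]
  nlinarith

theorem norm_binomialSum_le_of_lt {k : ℕ} (hk1 : 1 ≤ k) (hk : Nat.gcd k (p - 1) = 1)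
    (hp : Real.exp 340 < p)
    (hh : (p : ℝ) ^ (23 / 80 : ℝ) < ((p - 1) / Nat.gcd (k - 1) (p - 1) : ℕ))
    {a b : ZMod p} (ha : a ≠ 0) (hb : b ≠ 0) :
    ‖binomialSum p k a b‖ ≤ 0.8 * (p : ℝ) ^ (89 / 92 : ℝ) := by
  have hp0 : (0 : ℝ) < p := (Real.exp_pos _).trans hp
  have hp1 := (Fact.out : p.Prime).one_lt
  set t : ℝ := (p : ℝ) ^ (1 / 80 : ℝ) with ht
  have htpow : ∀ m : ℕ, t ^ m = (p : ℝ) ^ (m / 80 : ℝ) := by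
    intro m
    rw [ht, ← Real.rpow_natCast, ← Real.rpow_mul hp0.le]
    congr 1
    ring
  have ht70 : 70 ≤ t := by
    have h1 : Real.exp (17 / 4) * (p : ℝ) ^ (0 : ℝ) ≤ t :=
      exp_mul_rpow_le hp (by norm_num) (by norm_num)
    rw [Real.rpow_zero, mul_one] at h1
    refine le_trans ?_ h1
    refine le_of_pow_le_pow_left₀ (n := 4) (by norm_num) (Real.exp_pos _).le ?_
    rw [← Real.exp_nat_mul]
    have h2 : Real.exp ((4 : ℕ) * (17 / 4)) = Real.exp 1 ^ 17 := by
      rw [← Real.exp_nat_mul]; norm_num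
    rw [h2]
    calc (70 : ℝ) ^ 4 ≤ 2.718 ^ 17 := by norm_num
      _ ≤ _ := by gcongr; linarith [Real.exp_one_gt_d9]
  have hpt : (p : ℝ) = t ^ 80 := by
    rw [htpow]; norm_num
  have hord : ∀ r : ℕ, 0 < r → (r : ℝ) ≤ t ^ 23 → ¬ (p - 1) ∣ r * (k - 1) := by
    intro r hr hrt
    refine not_dvd_mul_of_lt_div_gcd (by omega) hr ?_
    have h1 := hrt.trans_lt ((htpow 23).trans_lt (by exact_mod_cast hh))
    exact_mod_cast h1
  have hN := norm_sq_binomialSum_le_of_card_le hk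
    (fun c => card_filter_one_sub_pow_le ht70 hpt hk1 hk hord c) ha hb
  set q : ℝ := (p : ℝ) ^ (309 / 160 : ℝ) with hq
  have hq0 : 0 < q := by positivity
  have hq2 : q ^ 2 = (p : ℝ) * (t ^ 69 * (p * p)) := by
    rw [htpow, hq, ← Real.rpow_natCast, ← Real.rpow_mul hp0.le]
    have h1 : (p : ℝ) * ((p : ℝ) ^ (((69 : ℕ) : ℝ) / 80) * (p * p)) =
        (p : ℝ) ^ (3 : ℝ) * (p : ℝ) ^ (((69 : ℕ) : ℝ) / 80) := by
      rw [show (3 : ℝ) = ((3 : ℕ) : ℝ) by norm_num, Real.rpow_natCast]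
      ring
    rw [h1, ← Real.rpow_add hp0]
    norm_num
  have hsqrt : √(p * (4.01 * t ^ 69 * (p * p))) ≤ 2.003 * q := by
    apply Real.sqrt_le_iff.2
    refine ⟨by positivity, ?_⟩
    nlinarith [sq_nonneg q]
  have hpq : (p : ℝ) ≤ 0.01 * q := by
    have h1 : Real.exp 99 * (p : ℝ) ^ (1 : ℝ) ≤ q :=
      exp_mul_rpow_le hp (by norm_num) (by norm_num)
    rw [Real.rpow_one] at h1
    have h2 := Real.add_one_le_exp (99 : ℝ)
    nlinarith
  have hP : 3.3 * q ≤ ((p : ℝ) ^ (89 / 92 : ℝ)) ^ 2 := by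
    rw [← Real.rpow_natCast, ← Real.rpow_mul hp0.le]
    have h1 : Real.exp (6 / 5) * q ≤ (p : ℝ) ^ (89 / 92 * (2 : ℕ) : ℝ) :=
      exp_mul_rpow_le hp (by norm_num) (by norm_num)
    refine le_trans ?_ h1
    gcongr
    refine le_of_pow_le_pow_left₀ (n := 5) (by norm_num) (Real.exp_pos _).le ?_
    rw [← Real.exp_nat_mul]
    have h2 : Real.exp ((5 : ℕ) * (6 / 5)) = Real.exp 1 ^ 6 := by
      rw [← Real.exp_nat_mul]; norm_num
    rw [h2]
    calc (3.3 : ℝ) ^ 5 ≤ 2.718 ^ 6 := by norm_num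
      _ ≤ _ := by gcongr; linarith [Real.exp_one_gt_d9]
  refine le_of_pow_le_pow_left₀ (n := 2) (by norm_num) (by positivity) ?_
  rw [mul_pow]
  nlinarith

end MainCase

section Numerics

theorem four_div_pi_sq_ge : 0.4052 ≤ 4 / Real.pi ^ 2 := by
  have h1 := Real.pi_lt_d4
  have h2 := Real.pi_pos
  rw [le_div_iff₀ (by positivity)]
  nlinarith

theorem sq_log_factor_le {l : ℝ} (hl : 340 ≤ l) :
    0.82 * (0.664 * l + 5) ^ 2 ≤ 2.293 * (4 / Real.pi ^ 2 * l + 0.381) ^ 2 := by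
  have h1 := four_div_pi_sq_ge
  have h2 : 0.5981 * (0.664 * l + 5) ≤ 4 / Real.pi ^ 2 * l + 0.381 := by nlinarith
  have h3 : (0.5981 * (0.664 * l + 5)) ^ 2 ≤ (4 / Real.pi ^ 2 * l + 0.381) ^ 2 := by
    gcongr
  nlinarith [sq_nonneg (0.664 * l + 5)]

theorem mul_log_factor_le {l m : ℝ} (hl : 340 ≤ l) (hm : m ≤ 23 / 80 * l) :
    (0.664 * m + 5) * (0.664 * l + 5) ≤ (4 / Real.pi ^ 2 * l + 0.381) ^ 2 := by
  have h1 := four_div_pi_sq_ge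
  have h2 : (0.4052 * l + 0.381) ^ 2 ≤ (4 / Real.pi ^ 2 * l + 0.381) ^ 2 := by gcongr
  refine le_trans ?_ h2
  have h3 : (0.664 * m + 5) * (0.664 * l + 5) ≤ (0.1909 * l + 5) * (0.664 * l + 5) :=
    mul_le_mul_of_nonneg_right (by linarith) (by linarith)
  nlinarith

theorem half_add_half_le_error_bound {x : ℝ} (h7 : 7 ≤ x) (hx : x ≤ Real.exp 340) :
    x / 2 + 1 / 2 ≤ (2 + 2.293 * x ^ (89 / 92 : ℝ)) *
      (4 / Real.pi ^ 2 * Real.log x + 0.381) ^ 2 := by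
  have hx0 : 0 < x := by linarith
  set l := Real.log x with hl
  have hl340 : l ≤ 340 := (Real.log_le_iff_le_exp hx0).2 hx
  have hl19 : 1.9 ≤ l := by
    rw [hl, Real.le_log_iff_exp_le hx0]
    refine le_trans ?_ h7
    refine le_of_pow_le_pow_left₀ (n := 10) (by norm_num) (by norm_num) ?_
    rw [← Real.exp_nat_mul]
    have h2 : Real.exp ((10 : ℕ) * 1.9) = Real.exp 1 ^ 19 := by
      rw [← Real.exp_nat_mul]; norm_num
    rw [h2]
    calc Real.exp 1 ^ 19 ≤ 2.7183 ^ 19 := by gcongr; linarith [Real.exp_one_lt_d9]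
      _ ≤ _ := by norm_num
  set B := 4 / Real.pi ^ 2 * l + 0.381 with hB
  have hBl : 0.4052 * l + 0.381 ≤ B := by
    have := four_div_pi_sq_ge
    rw [hB]; nlinarith
  have hexp : Real.exp (3 / 184 * l) ≤ 1 + l / 340 * 255 := by
    have hconv := convexOn_exp.2 (Set.mem_univ (0 : ℝ)) (Set.mem_univ (3 / 184 * 340 : ℝ))
      (show 0 ≤ 1 - l / 340 by linarith) (show 0 ≤ l / 340 by linarith) (by ring)
    simp only [smul_eq_mul, mul_zero, zero_add, Real.exp_zero, mul_one] at hconv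
    have h1 : Real.exp (3 / 184 * 340) ≤ 256 := by
      have h2 : (256 : ℝ) = Real.exp (8 * Real.log 2) := by
        rw [mul_comm, Real.exp_mul, Real.exp_log (by norm_num)]; norm_num
      rw [h2, Real.exp_le_exp]
      linarith [Real.log_two_gt_d9]
    have h3 : l / 340 * (3 / 184 * 340) = 3 / 184 * l := by ring
    rw [h3] at hconv
    nlinarith
  have hexpB : Real.exp (3 / 184 * l) ≤ 2.1414 * B := by nlinarith
  have hsplit : x = x ^ (89 / 92 : ℝ) * Real.exp (3 / 184 * l) ^ 2 := by
    rw [← Real.exp_nat_mul, Real.rpow_def_of_pos hx0, ← Real.exp_add, ← hl]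
    conv_lhs => rw [← Real.exp_log hx0]
    congr 1
    push_cast
    ring
  have hP : 0 < x ^ (89 / 92 : ℝ) := by positivity
  have h4 : Real.exp (3 / 184 * l) ^ 2 ≤ (2.1414 * B) ^ 2 := by gcongr
  have h5 : x ≤ x ^ (89 / 92 : ℝ) * (2.1414 * B) ^ 2 := by
    conv_lhs => rw [hsplit]
    gcongr
  have hB1 : 1 ≤ B := by linarith
  have hPB : 0 ≤ x ^ (89 / 92 : ℝ) * B ^ 2 := by positivity
  nlinarith

end Numerics

section Assembly

open Finset

theorem card_Iclass_bounds {p n j : ℕ} (hp : p.Prime) (hj : j < n) (hnp : n < p) :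
    p ≤ n * (Iclass p n j).card + n ∧ n * (Iclass p n j).card + 1 ≤ p + n := by
  have := Fact.mk hp
  have hn : 0 < n := by omega
  rw [Iclass_eq_image hj (hj.trans hnp), card_image_of_injective _ (by
    intro x y h
    exact Nat.eq_of_mul_eq_mul_left hn (by simpa using h)), Nat.card_Ico]
  have h1 := Nat.div_add_mod (p - 1 - j) n
  have h2 := Nat.mod_lt (p - 1 - j) hn
  generalize (p - 1 - j) / n = q at *
  split_ifs with h
  · rw [Nat.add_sub_cancel]
    omega
  · rw [Nat.sub_zero, mul_add, mul_one]
    omega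

theorem main_term_bounds {p n u v : ℝ} (hp : 0 < p) (hn : 2 ≤ n) (hnp : n ≤ p)
    (hu : p ≤ n * u + n) (hu' : n * u + 1 ≤ p + n) (hv : p ≤ n * v + n)
    (hv' : n * v + 1 ≤ p + n) :
    p / n ^ 2 - 1 < u * v / p ∧ u * v / p < p / n ^ 2 + 1 := by
  have hn0 : 0 < n ^ 2 := by positivity
  have h1 : (p - n) * (p - n) ≤ (n * u) * (n * v) :=
    mul_le_mul (by linarith) (by linarith) (by linarith) (by linarith)
  have h2 : (n * u) * (n * v) ≤ (p + n - 1) * (p + n - 1) :=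
    mul_le_mul (by linarith) (by linarith) (by linarith) (by linarith)
  have h3 : p / n ^ 2 - 1 = (p ^ 2 - n ^ 2 * p) / (n ^ 2 * p) := by field_simp
  have h4 : p / n ^ 2 + 1 = (p ^ 2 + n ^ 2 * p) / (n ^ 2 * p) := by field_simp
  have h5 : u * v / p = (n * u) * (n * v) / (n ^ 2 * p) := by field_simp
  have hnp' : 0 ≤ p * (n * (n - 2)) := by
    have : 0 ≤ n - 2 := by linarith
    positivity
  rw [h3, h4, h5]
  constructor
  · gcongr
    nlinarith
  · gcongr
    nlinarith [mul_nonneg (show 0 ≤ p - 1 by linarith) (sq_nonneg (n - 1))]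

variable {p : ℕ} [Fact p.Prime]

theorem fmap_injOn {k : ℕ} {A : ℤ} (hk1 : 1 ≤ k) (hk : Nat.gcd k (p - 1) = 1)
    (hA : (A : ZMod p) ≠ 0) (n i : ℕ) : Set.InjOn (fmap p A k) (Iclass p n i) := by
  intro x hx y hy h
  exact Iclass_cast_injOn n i hx hy ((bijective_mul_pow hk1 hk hA).1 (ZMod.val_injective p h))

theorem natCast_val_mem_Iclass_iff (n j : ℕ) (y : ZMod p) :
    y.val ∈ Iclass p n j ↔ y ∈ (Iclass p n j).image fun x : ℕ => (x : ZMod p) := by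
  rw [mem_image]
  constructor
  · exact fun h => ⟨y.val, h, ZMod.natCast_zmod_val y⟩
  · rintro ⟨m, hm, rfl⟩
    have h1 := (mem_Icc.1 (mem_filter.1 hm).1)
    rwa [ZMod.val_natCast_of_lt (by have := (Fact.out : p.Prime).pos; omega)]

open Classical in
theorem card_image_fmap_inter {k : ℕ} {A : ℤ} (hk1 : 1 ≤ k) (hk : Nat.gcd k (p - 1) = 1)
    (hA : (A : ZMod p) ≠ 0) (n i j : ℕ) :
    ((Iclass p n i).image (fmap p A k) ∩ Iclass p n j).card =
      (((Iclass p n i).image fun x : ℕ => (x : ZMod p)).filter fun x =>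
        (A : ZMod p) * x ^ k ∈ (Iclass p n j).image fun x : ℕ => (x : ZMod p)).card := by
  rw [← filter_mem_eq_inter, filter_image, filter_image,
    card_image_of_injOn ((fmap_injOn hk1 hk hA n i).mono (filter_subset _ _)),
    card_image_of_injOn ((Iclass_cast_injOn n i).mono (filter_subset _ _))]
  congr 1
  refine filter_congr fun x _ => ?_
  exact natCast_val_mem_Iclass_iff n j _

theorem abs_card_inter_sub_le {n k : ℕ} {A : ℤ} (hA : (A : ZMod p) ≠ 0) (hk1 : 1 ≤ k)
    (hk : Nat.gcd k (p - 1) = 1) (hnp : n < p) {i j : ℕ} (hi : i < n) (hj : j < n)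
    (hp : Real.exp 340 < p) :
    |((((Iclass p n i).image (fmap p A k)) ∩ Iclass p n j).card : ℝ) -
      (Iclass p n i).card * (Iclass p n j).card / p| ≤
      ((Nat.gcd (k - 1) (p - 1) : ℝ) + 1 + 2.293 * (p : ℝ) ^ (89 / 92 : ℝ)) *
        (4 / Real.pi ^ 2 * Real.log p + 0.381) ^ 2 := by
  classical
  have hp0 : (0 : ℝ) < p := (Real.exp_pos _).trans hp
  have hn0 : (-(n : ZMod p)) ≠ 0 := by
    rw [neg_ne_zero, Ne, ZMod.natCast_eq_zero_iff]
    exact Nat.not_dvd_of_pos_of_lt (by omega) hnp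
  have hlog : 340 ≤ Real.log p := ((Real.lt_log_iff_exp_lt hp0).2 hp).le
  set d := Nat.gcd (k - 1) (p - 1) with hd
  set h := (p - 1) / d with hh
  set P := (p : ℝ) ^ (89 / 92 : ℝ) with hP
  have hP100 : 100 ≤ P := by
    have h1 : Real.exp 99 * (p : ℝ) ^ (0 : ℝ) ≤ P :=
      exp_mul_rpow_le hp (by norm_num) (by norm_num)
    rw [Real.rpow_zero, mul_one] at h1
    linarith [Real.add_one_le_exp (99 : ℝ)]
  rw [card_image_fmap_inter hk1 hk hA, ← card_image_of_injOn (Iclass_cast_injOn (p := p) n i),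
    ← card_image_of_injOn (Iclass_cast_injOn (p := p) n j)]
  have hbox := fun {M D : ℝ} (hM : 0 ≤ M) (hD : 0 ≤ D) {H : ℕ} =>
    abs_card_sub_le_of_norm_sum_le _ _ (bijective_mul_pow hk1 hk hA) hn0
      (norm_sum_Iclass_mul_le hi hnp) (norm_sum_Iclass_mul_le hj hnp) hM hD (H := H)
  have hT : ∀ a b : ZMod p, ‖∑ x, (ZMod.stdAddChar (a * x + b * ((A : ZMod p) * x ^ k)) : ℂ)‖ ≤
      1 + ‖binomialSum p k a (b * A)‖ := by
    intro a b
    simp only [← mul_assoc]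
    rw [sum_stdAddChar_eq_one_add_binomialSum hk1]
    exact (norm_add_le _ _).trans (by rw [norm_one])
  have hnum := sq_log_factor_le hlog
  set B := (4 / Real.pi ^ 2 * Real.log p + 0.381) ^ 2 with hB
  have hB0 : 0 ≤ B := sq_nonneg _
  have hfirst : 0.82 * P * (0.664 * Real.log p + 5) ^ 2 ≤ 2.293 * P * B := by nlinarith
  rcases lt_or_ge ((p : ℝ) ^ (23 / 80 : ℝ)) (h : ℝ) with hlt | hge
  · refine (hbox (M := 0.82 * P) (D := 0) (H := 0) (by positivity) le_rfl (fun _ => ∅)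
      (by simp) (by simp) ?_).trans ?_
    · intro a b ha hb
      have h1 := norm_binomialSum_le_of_lt hk1 hk hp hlt ha (mul_ne_zero hb hA)
      have h2 := hT a b
      rw [ite_self, add_zero]
      linarith
    · have : 0 ≤ ((d : ℝ) + 1) * B := by positivity
      linarith
  · have hex : ∀ b : ZMod p, ∃ R : Finset (ZMod p), (∀ a ∈ R, a ≠ 0) ∧ (b ≠ 0 → R.card ≤ h ∧
        ∀ a, ‖binomialSum p k a (b * A)‖ ≤ h * √p + if a ∈ R then (d : ℝ) else 0) := by
      intro b
      rcases eq_or_ne b 0 with hb | hb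
      · exact ⟨∅, by simp, fun h => absurd hb h⟩
      · obtain ⟨R, h1, h2, h3⟩ := exists_norm_binomialSum_le hk1 (mul_ne_zero hb hA)
        refine ⟨R, h1, fun _ => ⟨h2, fun a => ?_⟩⟩
        convert h3 a
    choose R hR hRb using hex
    have hsqrt : (h : ℝ) * √p ≤ (p : ℝ) ^ (63 / 80 : ℝ) := by
      have h1 : (p : ℝ) ^ (63 / 80 : ℝ) = (p : ℝ) ^ (23 / 80 : ℝ) * √p := by
        rw [Real.sqrt_eq_rpow, ← Real.rpow_add hp0]
        norm_num
      rw [h1]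
      gcongr
    have hsmall : (p : ℝ) ^ (63 / 80 : ℝ) ≤ 0.1 * P := by
      have h1 : Real.exp 60 * (p : ℝ) ^ (63 / 80 : ℝ) ≤ P :=
        exp_mul_rpow_le hp (by norm_num) (by norm_num)
      have h2 := Real.add_one_le_exp (60 : ℝ)
      have h3 : 0 < (p : ℝ) ^ (63 / 80 : ℝ) := by positivity
      nlinarith
    refine (hbox (M := 0.82 * P) (D := d) (H := h) (by positivity) (by positivity) R hR
      (fun b hb => (hRb b hb).1) ?_).trans ?_
    · intro a b _ hb
      have h1 := (hRb b hb).2 a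
      have h2 := hT a b
      linarith
    · have hlogh : Real.log h ≤ 23 / 80 * Real.log p := by
        rcases Nat.eq_zero_or_pos h with h0 | h0
        · rw [h0, Nat.cast_zero, Real.log_zero]; positivity
        · rw [← Real.log_rpow hp0]
          exact Real.log_le_log (by exact_mod_cast h0) hge
      have h2 := mul_le_mul_of_nonneg_left (mul_log_factor_le hlog hlogh)
        (Nat.cast_nonneg (α := ℝ) d)
      rw [← hB] at h2
      linarith

theorem abs_card_inter_sub_le_of_le {n k : ℕ} {A : ℤ} (h7 : 7 ≤ p) (hn : 2 ≤ n) (hnp : n < p)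
    {i j : ℕ} (hi : i < n) (hp : (p : ℝ) ≤ Real.exp 340) :
    |((((Iclass p n i).image (fmap p A k)) ∩ Iclass p n j).card : ℝ) -
      (Iclass p n i).card * (Iclass p n j).card / p| ≤
      ((Nat.gcd (k - 1) (p - 1) : ℝ) + 1 + 2.293 * (p : ℝ) ^ (89 / 92 : ℝ)) *
        (4 / Real.pi ^ 2 * Real.log p + 0.381) ^ 2 := by
  have h7' : (7 : ℝ) ≤ p := by exact_mod_cast h7
  have hu := (card_Iclass_bounds (Fact.out : p.Prime) hi hnp).2
  have hC : (((Iclass p n i).image (fmap p A k)) ∩ Iclass p n j).card ≤ (Iclass p n i).card :=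
    (card_le_card inter_subset_left).trans card_image_le
  have hv : (Iclass p n j).card ≤ p := by
    refine (card_filter_le _ _).trans ?_
    rw [Nat.card_Icc]; omega
  have hu2 : 2 * (Iclass p n i).card ≤ p + 1 := by nlinarith
  have hd : 1 ≤ Nat.gcd (k - 1) (p - 1) := Nat.gcd_pos_of_pos_right _ (by omega)
  have hC' : ((((Iclass p n i).image (fmap p A k)) ∩ Iclass p n j).card : ℝ) ≤
    (Iclass p n i).card := by exact_mod_cast hC
  have hv' : ((Iclass p n j).card : ℝ) ≤ p := by exact_mod_cast hv
  have hu2' : 2 * ((Iclass p n i).card : ℝ) ≤ p + 1 := by exact_mod_cast hu2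
  have hd' : (1 : ℝ) ≤ (Nat.gcd (k - 1) (p - 1) : ℝ) := by exact_mod_cast hd
  have hmain : ((Iclass p n i).card : ℝ) * (Iclass p n j).card / p ≤ (Iclass p n i).card := by
    rw [div_le_iff₀ (by linarith)]
    gcongr
  have hmain0 : 0 ≤ ((Iclass p n i).card : ℝ) * (Iclass p n j).card / p := by positivity
  have hC0 : 0 ≤ ((((Iclass p n i).image (fmap p A k)) ∩ Iclass p n j).card : ℝ) :=
    Nat.cast_nonneg _
  have hnum := half_add_half_le_error_bound h7' hp
  calc _ ≤ (p : ℝ) / 2 + 1 / 2 := by rw [abs_le]; constructor <;> linarith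
    _ ≤ _ := hnum
    _ ≤ _ := by gcongr; linarith

end Assembly

theorem stmt_14 (p n k : ℕ) (A : ℤ) (hp : p.Prime)
    (hA : 2 * |A| < (p : ℤ)) (hA0 : ¬ (p : ℤ) ∣ A)
    (hk1 : 1 ≤ k) (hk2 : k < p - 1) (hk3 : Nat.gcd k (p - 1) = 1)
    (hn : 2 ≤ n) (hnp : n < p) (i j : ℕ) (hi : i ≤ n - 1) (hj : j ≤ n - 1) :
    -- bounds on the main term `p⁻¹|I_i||I_j|`
    ((p : ℝ) / (n : ℝ) ^ 2 - 1 <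
        ((Iclass p n i).card : ℝ) * ((Iclass p n j).card : ℝ) / (p : ℝ) ∧
      ((Iclass p n i).card : ℝ) * ((Iclass p n j).card : ℝ) / (p : ℝ) <
        (p : ℝ) / (n : ℝ) ^ 2 + 1) ∧
    -- the case `p > 607`
    (607 < p → ∃ E : ℝ,
      ((((Iclass p n i).image (fmap p A k)) ∩ Iclass p n j).card : ℝ) =
        ((Iclass p n i).card : ℝ) * ((Iclass p n j).card : ℝ) / (p : ℝ) + E ∧
      |E| ≤ ((Nat.gcd (k - 1) (p - 1) : ℝ) + 1 + 2.293 * (p : ℝ) ^ ((89 : ℝ) / 92)) *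
        (4 / Real.pi ^ 2 * Real.log p + 0.381) ^ 2) ∧
    -- the case `7 ≤ p ≤ 607`, with `0.381` replaced by `1/2`
    (7 ≤ p → p ≤ 607 → ∃ E : ℝ,
      ((((Iclass p n i).image (fmap p A k)) ∩ Iclass p n j).card : ℝ) =
        ((Iclass p n i).card : ℝ) * ((Iclass p n j).card : ℝ) / (p : ℝ) + E ∧
      |E| ≤ ((Nat.gcd (k - 1) (p - 1) : ℝ) + 1 + 2.293 * (p : ℝ) ^ ((89 : ℝ) / 92)) *
        (4 / Real.pi ^ 2 * Real.log p + 1 / 2) ^ 2) := by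
  have := Fact.mk hp
  have hi' : i < n := by omega
  have hj' : j < n := by omega
  have hA' : (A : ZMod p) ≠ 0 := by rwa [Ne, ZMod.intCast_zmod_eq_zero_iff_dvd]
  have hlog : 0 ≤ Real.log p := Real.log_natCast_nonneg p
  have key : 7 ≤ p → _ := fun h7 => (le_or_gt (p : ℝ) (Real.exp 340)).elim
    (abs_card_inter_sub_le_of_le (k := k) (A := A) h7 hn hnp hi')
    (abs_card_inter_sub_le hA' hk1 hk3 hnp hi' hj')
  refine ⟨?_, fun h => ⟨_, (add_sub_cancel _ _).symm, key (by omega)⟩,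
    fun h _ => ⟨_, (add_sub_cancel _ _).symm, (key h).trans ?_⟩⟩
  · obtain ⟨hu, hu'⟩ := card_Iclass_bounds hp hi' hnp
    obtain ⟨hv, hv'⟩ := card_Iclass_bounds hp hj' hnp
    exact main_term_bounds (by exact_mod_cast hp.pos) (by exact_mod_cast hn)
      (by exact_mod_cast hnp.le) (by exact_mod_cast hu) (by exact_mod_cast hu')
      (by exact_mod_cast hv) (by exact_mod_cast hv')
  · gcongr
    norm_num
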